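/- arXiv:1609.06675 — 2 statements merged into one kernel-verified Lean document; each statement's English description precedes it below -/
import Mathlib

section
/- Let G₁,…,G_M be a partition of {1,…,p} with each |G_k| = T = p/M, let f ∈ ℝⁿ, ξ ∼ N(0, σ²I_{n×n}), y = f + ξ, and assume the diagonal elements of (1/n)𝕏ᵀ𝕏 are at most 1. Let ψ* = max_k ‖𝕏_{G_k}‖_sp/√n and let λ ≥ (2σ/√n)( √T + ψ*√(2 log(2M)) ). Let β̂ be any solution of the group LASSO problem min_{β∈ℝᵖ}( ‖y − 𝕏β‖² + 2λ∑_{k=1}^M |β_{G_k}|₂ ). Then for any δ ∈ (0,1), with probability at least 1 − δ, ‖𝕏β̂ − f‖ ≤ min over S ⊆ {1,…,M} of [ min_{β: 𝒦(β)=S} ‖𝕏β − f‖ + 3λ√|S|/(2κ_G(S,3)) ] + σΦ⁻¹(1−δ)/√n; moreover E‖𝕏β̂ − f‖ ≤ min over S ⊆ {1,…,M} of [ min_{β: 𝒦(β)=S} ‖𝕏β − f‖ + 3λ√|S|/(2κ_G(S,3)) ] + σ/√(2πn), with the convention a/0 = +∞ for a > 0. -/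
open MeasureTheory ProbabilityTheory
open scoped ENNReal

/-- The scaled Euclidean norm `‖u‖ = sqrt((1/n) ∑ u_i²)` on `ℝⁿ`. -/
noncomputable def scaledNorm {n : ℕ} (u : Fin n → ℝ) : ℝ :=
  Real.sqrt ((∑ i, u i ^ 2) / n)

/-- The standard normal cumulative distribution function `Φ`. -/
noncomputable def stdPhi (t : ℝ) : ℝ :=
  (gaussianReal 0 1 (Set.Iic t)).toReal

/-- The Gaussian measure `N(0, σ²I_{n×n})` on `ℝⁿ` (i.i.d. `N(0,σ²)` components). -/
noncomputable def gaussianVec (n : ℕ) (σ : ℝ) : Measure (Fin n → ℝ) :=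
  Measure.pi fun _ : Fin n => gaussianReal 0 ⟨σ ^ 2, sq_nonneg σ⟩

/-- `|β_{G_k}|₂`: the Euclidean norm of `β` restricted to the group `G k`. -/
noncomputable def groupNorm {p : ℕ} (G : Finset (Fin p)) (β : Fin p → ℝ) : ℝ :=
  Real.sqrt (∑ j ∈ G, β j ^ 2)

/-- The spectral norm of the submatrix of `X` with columns indexed by `G`. -/
noncomputable def subSpecNorm {n p : ℕ} (X : Matrix (Fin n) (Fin p) ℝ)
    (G : Finset (Fin p)) : ℝ :=
  sSup {r | ∃ x : Fin p → ℝ, (∀ j ∉ G, x j = 0) ∧ (∑ j, x j ^ 2) ≤ 1 ∧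
    r = Real.sqrt (∑ i, X.mulVec x i ^ 2)}

/-- The squared group Restricted Eigenvalue constant. -/
noncomputable def kappaGSq {n p M : ℕ} (X : Matrix (Fin n) (Fin p) ℝ)
    (G : Fin M → Finset (Fin p)) (S : Finset (Fin M)) (c₀ : ℝ) : ℝ :=
  sInf {r | ∃ Δ : Fin p → ℝ, Δ ≠ 0 ∧
    (∑ k ∈ Sᶜ, groupNorm (G k) Δ) ≤ c₀ * ∑ k ∈ S, groupNorm (G k) Δ ∧
    r = scaledNorm (X.mulVec Δ) ^ 2 / ∑ j, Δ j ^ 2}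

section GroupLassoOracle

open Set Filter Topology

/-- The standard normal density. -/
noncomputable def stdDens (x : ℝ) : ℝ := (√(2 * Real.pi))⁻¹ * Real.exp (-x ^ 2 / 2)

lemma gaussianPDFReal_eq_stdDens (x : ℝ) : gaussianPDFReal 0 1 x = stdDens x := by
  simp [gaussianPDFReal, stdDens]

lemma stdDens_pos (x : ℝ) : 0 < stdDens x := by unfold stdDens; positivity

lemma stdDens_neg (x : ℝ) : stdDens (-x) = stdDens x := by simp [stdDens]

lemma hasDerivAt_stdDens (x : ℝ) : HasDerivAt stdDens (-x * stdDens x) x := by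
  have h1 : HasDerivAt (fun x : ℝ => -x ^ 2 / 2) (-x) x :=
    (((hasDerivAt_pow 2 x).fun_neg).div_const 2).congr_deriv (by norm_num; ring)
  exact ((h1.exp).const_mul (√(2 * Real.pi))⁻¹).congr_deriv (by rw [stdDens]; ring)

lemma continuous_stdDens : Continuous stdDens :=
  continuous_iff_continuousAt.2 fun x => (hasDerivAt_stdDens x).continuousAt

lemma stdDens_le_of_abs_le {x y : ℝ} (h : |x| ≤ |y|) : stdDens y ≤ stdDens x := by
  unfold stdDens
  have := sq_le_sq.2 h
  gcongr

lemma stdDens_le_one (x : ℝ) : stdDens x ≤ 1 := by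
  have h : 1 ≤ √(2 * Real.pi) := by
    rw [Real.one_le_sqrt]; linarith [Real.pi_gt_three]
  unfold stdDens
  have h2 : Real.exp (-x ^ 2 / 2) ≤ 1 := Real.exp_le_one_iff.2 (by nlinarith [sq_nonneg x])
  calc _ ≤ (√(2 * Real.pi))⁻¹ * 1 := by gcongr
    _ ≤ 1 := by simpa using inv_le_one_of_one_le₀ h

lemma abs_mul_stdDens_le_one (x : ℝ) : |x * stdDens x| ≤ 1 := by
  have h : 1 ≤ √(2 * Real.pi) := by
    rw [Real.one_le_sqrt]; linarith [Real.pi_gt_three]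
  have h2 : |x| * Real.exp (-x ^ 2 / 2) ≤ 1 := by
    have h3 := Real.add_one_le_exp (x ^ 2 / 2)
    have h4 : |x| ≤ x ^ 2 / 2 + 1 := by nlinarith [sq_nonneg (|x| - 1), sq_abs x]
    rw [neg_div, Real.exp_neg, ← div_eq_mul_inv, div_le_one (Real.exp_pos _)]
    linarith
  rw [abs_mul, abs_of_pos (stdDens_pos x)]
  unfold stdDens
  calc _ = (√(2 * Real.pi))⁻¹ * (|x| * Real.exp (-x ^ 2 / 2)) := by ring
    _ ≤ 1 * 1 := by
      gcongr
      exact inv_le_one_of_one_le₀ h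
    _ = 1 := by ring

lemma integrable_stdDens : Integrable stdDens := by
  have := integrable_gaussianPDFReal 0 1
  rwa [show gaussianPDFReal 0 1 = stdDens from funext gaussianPDFReal_eq_stdDens] at this

lemma stdPhi_eq_integral (t : ℝ) : stdPhi t = ∫ x in Iic t, stdDens x := by
  rw [stdPhi, gaussianReal_apply_eq_integral 0 one_ne_zero, ENNReal.toReal_ofReal]
  · simp_rw [gaussianPDFReal_eq_stdDens]
  · exact integral_nonneg fun x => gaussianPDFReal_nonneg _ _ _

lemma stdPhi_sub (a b : ℝ) : stdPhi b - stdPhi a = ∫ x in a..b, stdDens x := by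
  rw [stdPhi_eq_integral, stdPhi_eq_integral]
  exact intervalIntegral.integral_Iic_sub_Iic integrable_stdDens.integrableOn
    integrable_stdDens.integrableOn

lemma hasDerivAt_stdPhi (x : ℝ) : HasDerivAt stdPhi (stdDens x) x := by
  have h : stdPhi = fun t => stdPhi 0 + ∫ x in (0 : ℝ)..t, stdDens x := by
    ext t; rw [← stdPhi_sub]; ring
  rw [h]
  exact (intervalIntegral.integral_hasDerivAt_right
    (continuous_stdDens.intervalIntegrable _ _)
    (continuous_stdDens.stronglyMeasurableAtFilter _ _) continuous_stdDens.continuousAt).const_add _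

lemma continuous_stdPhi : Continuous stdPhi :=
  continuous_iff_continuousAt.2 fun x => (hasDerivAt_stdPhi x).continuousAt

lemma strictMono_stdPhi : StrictMono stdPhi :=
  strictMono_of_hasDerivAt_pos hasDerivAt_stdPhi stdDens_pos

lemma stdPhi_eq_cdf : stdPhi = cdf (gaussianReal 0 1) := by
  ext t; rw [cdf_eq_real]; rfl

lemma stdPhi_pos (x : ℝ) : 0 < stdPhi x := by
  have h : 0 ≤ stdPhi (x - 1) := ENNReal.toReal_nonneg
  exact h.trans_lt (strictMono_stdPhi (by linarith))

lemma stdPhi_lt_one (x : ℝ) : stdPhi x < 1 := by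
  have h : stdPhi (x + 1) ≤ 1 := by rw [stdPhi_eq_cdf]; exact cdf_le_one _ _
  exact (strictMono_stdPhi (by linarith)).trans_le h

lemma tendsto_stdPhi_atTop : Tendsto stdPhi atTop (𝓝 1) := by
  rw [stdPhi_eq_cdf]; exact tendsto_cdf_atTop _

lemma tendsto_stdPhi_atBot : Tendsto stdPhi atBot (𝓝 0) := by
  rw [stdPhi_eq_cdf]; exact tendsto_cdf_atBot _

lemma one_sub_stdPhi (x : ℝ) : 1 - stdPhi x = ∫ y in Ioi x, stdDens y := by
  have h : ∫ y, stdDens y = 1 := by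
    simpa [gaussianPDFReal_eq_stdDens] using integral_gaussianPDFReal_eq_one 0 one_ne_zero
  rw [← h, stdPhi_eq_integral, ← integral_add_compl (s := Iic x) measurableSet_Iic integrable_stdDens,
    compl_Iic]
  ring

lemma stdPhi_neg (x : ℝ) : stdPhi (-x) = 1 - stdPhi x := by
  rw [one_sub_stdPhi, stdPhi_eq_integral, ← integral_comp_neg_Ioi]
  simp [stdDens_neg]

lemma stdPhi_zero : stdPhi 0 = 1 / 2 := by
  have := stdPhi_neg 0
  rw [neg_zero] at this
  linarith

lemma exists_stdPhi_eq {y : ℝ} (h0 : 0 < y) (h1 : y < 1) : ∃ x, stdPhi x = y := by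
  obtain ⟨a, ha⟩ := (tendsto_stdPhi_atBot.eventually (gt_mem_nhds h0)).exists
  obtain ⟨b, hb⟩ := (tendsto_stdPhi_atTop.eventually (lt_mem_nhds h1)).exists
  obtain ⟨x, hx⟩ := mem_range_of_exists_le_of_exists_ge continuous_stdPhi ⟨a, ha.le⟩ ⟨b, hb.le⟩
  exact ⟨x, hx⟩

lemma abs_stdDens_sub_le (a b : ℝ) : |stdDens b - stdDens a| ≤ |b - a| := by
  have := Convex.norm_image_sub_le_of_norm_hasDerivWithin_le (f := stdDens) (s := univ) (C := 1)
    (fun x _ => (hasDerivAt_stdDens x).hasDerivWithinAt)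
    (fun x _ => by simpa [abs_mul] using abs_mul_stdDens_le_one x) convex_univ
    (mem_univ a) (mem_univ b)
  simpa using this

lemma abs_stdPhi_taylor (a b : ℝ) :
    |stdPhi b - stdPhi a - stdDens a * (b - a)| ≤ (b - a) ^ 2 := by
  have h : stdPhi b - stdPhi a - stdDens a * (b - a) = ∫ x in a..b, (stdDens x - stdDens a) := by
    rw [intervalIntegral.integral_sub (continuous_stdDens.intervalIntegrable _ _) (by simp),
      stdPhi_sub]
    simp; ring
  rw [h]
  have := intervalIntegral.norm_integral_le_of_norm_le_const (a := a) (b := b) (C := |b - a|)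
    (f := fun x => stdDens x - stdDens a) (fun x hx => ?_)
  · simpa [← sq] using this
  · refine (abs_stdDens_sub_le a x).trans ?_
    exact abs_sub_left_of_mem_uIcc (uIoc_subset_uIcc hx)

lemma tendsto_stdDens_atTop : Tendsto stdDens atTop (𝓝 0) := by
  have h : Tendsto (fun x : ℝ => -x ^ 2 / 2) atTop atBot := by
    have h1 : Tendsto (fun x : ℝ => x ^ 2 / 2) atTop atTop :=
      (tendsto_pow_atTop two_ne_zero).atTop_div_const two_pos
    simpa only [neg_div, Function.comp_def] using tendsto_neg_atTop_atBot.comp h1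
  simpa [Function.comp_def, funext_iff, stdDens, show stdDens = fun x => _ from rfl] using
    (Real.tendsto_exp_atBot.comp h).const_mul (√(2 * Real.pi))⁻¹

lemma lintegral_ofReal_gaussianReal :
    ∫⁻ x, ENNReal.ofReal x ∂(gaussianReal 0 1) = ENNReal.ofReal (√(2 * Real.pi))⁻¹ := by
  have hd : ∀ x ∈ Ici (0 : ℝ), HasDerivAt (fun x => -stdDens x) (x * stdDens x) x := by
    intro x _
    simpa using (hasDerivAt_stdDens x).fun_neg
  have hnn : ∀ x ∈ Ioi (0 : ℝ), 0 ≤ x * stdDens x := fun x hx =>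
    mul_nonneg (le_of_lt hx) (stdDens_pos x).le
  have ht : Tendsto (fun x => -stdDens x) atTop (𝓝 0) := by
    simpa using tendsto_stdDens_atTop.neg
  have h0 : stdDens 0 = (√(2 * Real.pi))⁻¹ := by simp [stdDens]
  rw [gaussianReal_of_var_ne_zero 0 one_ne_zero,
    lintegral_withDensity_eq_lintegral_mul _ (measurable_gaussianPDF 0 1) (by fun_prop),
    ← lintegral_add_compl _ (measurableSet_Ioi (a := (0 : ℝ))), compl_Ioi]
  have h1 : ∫⁻ x in Iic (0 : ℝ), (gaussianPDF 0 1 * fun x => ENNReal.ofReal x) x = 0 := by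
    rw [setLIntegral_congr_fun (g := fun _ => 0) measurableSet_Iic]
    · simp
    · intro x hx
      simp [ENNReal.ofReal_of_nonpos hx]
  have h2 : ∫⁻ x in Ioi (0 : ℝ), (gaussianPDF 0 1 * fun x => ENNReal.ofReal x) x =
      ∫⁻ x in Ioi (0 : ℝ), ENNReal.ofReal (x * stdDens x) := by
    refine setLIntegral_congr_fun measurableSet_Ioi fun x hx => ?_
    simp only [Pi.mul_apply, gaussianPDF, gaussianPDFReal_eq_stdDens]
    rw [← ENNReal.ofReal_mul (stdDens_pos x).le, mul_comm]
  rw [h1, h2, add_zero, ← ofReal_integral_eq_lintegral_ofReal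
      (integrableOn_Ioi_deriv_of_nonneg' hd hnn ht)
      ((ae_restrict_iff' measurableSet_Ioi).2 (ae_of_all _ hnn)),
    integral_Ioi_of_hasDerivAt_of_nonneg' hd hnn ht, h0]
  simp

/-- The standard normal quantile function `Φ⁻¹`. -/
noncomputable def stdQuantile (y : ℝ) : ℝ := Function.invFun stdPhi y

/-- The Gaussian isoperimetric profile `φ ∘ Φ⁻¹`. -/
noncomputable def isoProfile (y : ℝ) : ℝ := stdDens (stdQuantile y)

lemma stdQuantile_stdPhi (x : ℝ) : stdQuantile (stdPhi x) = x :=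
  Function.leftInverse_invFun strictMono_stdPhi.injective x

lemma isoProfile_stdPhi (x : ℝ) : isoProfile (stdPhi x) = stdDens x := by
  rw [isoProfile, stdQuantile_stdPhi]

lemma stdPhi_mem_Ioo (x : ℝ) : stdPhi x ∈ Ioo (0 : ℝ) 1 := ⟨stdPhi_pos x, stdPhi_lt_one x⟩

lemma stdPhi_stdQuantile {y : ℝ} (hy : y ∈ Ioo (0 : ℝ) 1) : stdPhi (stdQuantile y) = y :=
  Function.invFun_eq (exists_stdPhi_eq hy.1 hy.2)

lemma strictMonoOn_stdQuantile : StrictMonoOn stdQuantile (Ioo 0 1) := by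
  intro a ha b hb hab
  rw [← strictMono_stdPhi.lt_iff_lt, stdPhi_stdQuantile ha, stdPhi_stdQuantile hb]
  exact hab

lemma stdQuantile_one_sub {y : ℝ} (hy : y ∈ Ioo (0 : ℝ) 1) :
    stdQuantile (1 - y) = -stdQuantile y := by
  conv_lhs => rw [← stdPhi_stdQuantile hy, ← stdPhi_neg]
  exact stdQuantile_stdPhi _

lemma isoProfile_one_sub {y : ℝ} (hy : y ∈ Ioo (0 : ℝ) 1) :
    isoProfile (1 - y) = isoProfile y := by
  rw [isoProfile, stdQuantile_one_sub hy, stdDens_neg, isoProfile]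

lemma isoProfile_pos (y : ℝ) : 0 < isoProfile y := stdDens_pos _

lemma continuousAt_stdQuantile {y : ℝ} (hy : y ∈ Ioo (0 : ℝ) 1) : ContinuousAt stdQuantile y := by
  refine strictMonoOn_stdQuantile.continuousAt_of_image_mem_nhds (Ioo_mem_nhds hy.1 hy.2) ?_
  have : stdQuantile '' Ioo 0 1 = univ :=
    eq_univ_of_forall fun x => ⟨stdPhi x, stdPhi_mem_Ioo x, stdQuantile_stdPhi x⟩
  rw [this]
  exact univ_mem

lemma hasDerivAt_stdQuantile {y : ℝ} (hy : y ∈ Ioo (0 : ℝ) 1) :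
    HasDerivAt stdQuantile (isoProfile y)⁻¹ y :=
  (hasDerivAt_stdPhi _).of_local_left_inverse (continuousAt_stdQuantile hy) (stdDens_pos _).ne'
    (by filter_upwards [Ioo_mem_nhds hy.1 hy.2] with x hx using stdPhi_stdQuantile hx)

lemma hasDerivAt_isoProfile {y : ℝ} (hy : y ∈ Ioo (0 : ℝ) 1) :
    HasDerivAt isoProfile (-stdQuantile y) y := by
  refine ((hasDerivAt_stdDens _).comp y (hasDerivAt_stdQuantile hy)).congr_deriv ?_
  have := (isoProfile_pos y).ne'
  change -stdQuantile y * isoProfile y * _ = _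
  field_simp

lemma le_of_hasDerivAt_nonneg {f f' : ℝ → ℝ} {a b : ℝ} (hab : a ≤ b)
    (h : ∀ t ∈ Icc a b, HasDerivAt f (f' t) t) (h0 : ∀ t ∈ Icc a b, 0 ≤ f' t) : f a ≤ f b := by
  refine monotoneOn_of_deriv_nonneg (convex_Icc a b)
    (fun t ht => (h t ht).continuousAt.continuousWithinAt)
    (fun t ht => (h t (interior_subset ht)).differentiableAt.differentiableWithinAt)
    (fun t ht => ?_) (left_mem_Icc.2 hab) (right_mem_Icc.2 hab) hab
  rw [(h t (interior_subset ht)).deriv]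
  exact h0 t (interior_subset ht)

lemma monotone_div_stdDens : Monotone fun u : ℝ => u / stdDens u := by
  refine monotone_of_hasDerivAt_nonneg (f' := fun u => (1 + u ^ 2) / stdDens u) (fun u => ?_)
    fun u => ?_
  · refine ((hasDerivAt_id u).div (hasDerivAt_stdDens u) (stdDens_pos u).ne').congr_deriv ?_
    have := (stdDens_pos u).ne'
    simp only [id]
    field_simp
    ring
  · have := stdDens_pos u
    simp only [Pi.zero_apply]
    positivity

section TwoPoint

variable {c x : ℝ}

lemma add_sub_mem_Ioo (h0 : 0 < c - x) (h1 : c + x < 1) {t : ℝ} (ht : t ∈ Icc 0 x) :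
    c + t ∈ Ioo (0 : ℝ) 1 ∧ c - t ∈ Ioo (0 : ℝ) 1 := by
  obtain ⟨h2, h3⟩ := ht
  exact ⟨⟨by linarith, by linarith⟩, ⟨by linarith, by linarith⟩⟩

lemma HasDerivAt.comp_symm_pair {g g' : ℝ → ℝ} (hg : ∀ y ∈ Ioo (0 : ℝ) 1, HasDerivAt g (g' y) y)
    (h0 : 0 < c - x) (h1 : c + x < 1) {t : ℝ} (ht : t ∈ Icc 0 x) :
    HasDerivAt (fun t => g (c + t)) (g' (c + t)) t ∧
      HasDerivAt (fun t => g (c - t)) (-g' (c - t)) t := by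
  obtain ⟨h2, h3⟩ := add_sub_mem_Ioo h0 h1 ht
  exact ⟨(hg _ h2).comp_const_add c t, (hg _ h3).comp_const_sub c t⟩

lemma hasDerivAt_isoProfile_sq {y : ℝ} (hy : y ∈ Ioo (0 : ℝ) 1) :
    HasDerivAt (fun y => isoProfile y ^ 2) (-2 * (isoProfile y * stdQuantile y)) y :=
  ((hasDerivAt_isoProfile hy).fun_pow 2).congr_deriv (by norm_num; ring)

lemma hasDerivAt_isoProfile_mul_stdQuantile {y : ℝ} (hy : y ∈ Ioo (0 : ℝ) 1) :
    HasDerivAt (fun y => isoProfile y * stdQuantile y) (1 - stdQuantile y ^ 2) y := by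
  refine ((hasDerivAt_isoProfile hy).fun_mul (hasDerivAt_stdQuantile hy)).congr_deriv ?_
  have := (isoProfile_pos y).ne'
  field_simp
  ring

lemma hasDerivAt_stdQuantile_sq {y : ℝ} (hy : y ∈ Ioo (0 : ℝ) 1) :
    HasDerivAt (fun y => stdQuantile y ^ 2) (2 * (stdQuantile y / isoProfile y)) y :=
  ((hasDerivAt_stdQuantile hy).fun_pow 2).congr_deriv (by norm_num; ring)

lemma stdQuantile_sq_midpoint (hx : 0 ≤ x) (h0 : 0 < c - x) (h1 : c + x < 1) :
    2 * stdQuantile c ^ 2 ≤ stdQuantile (c + x) ^ 2 + stdQuantile (c - x) ^ 2 := by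
  have := le_of_hasDerivAt_nonneg hx
    (f := fun t => stdQuantile (c + t) ^ 2 + stdQuantile (c - t) ^ 2)
    (fun t ht => by
      obtain ⟨h2, h3⟩ := HasDerivAt.comp_symm_pair (fun y => hasDerivAt_stdQuantile_sq) h0 h1 ht
      exact h2.add h3)
    (fun t ht => by
      obtain ⟨h2, h3⟩ := add_sub_mem_Ioo h0 h1 ht
      have := monotone_div_stdDens (strictMonoOn_stdQuantile.monotoneOn h3 h2 (by linarith [ht.1]))
      simp only [isoProfile] at *
      linarith)
  simp only [add_zero, sub_zero] at this
  linarith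

lemma isoProfile_sq_second_difference (hx : 0 ≤ x) (h0 : 0 < c - x) (h1 : c + x < 1) :
    2 * stdQuantile c ^ 2 * x ^ 2 ≤
      isoProfile (c + x) ^ 2 + isoProfile (c - x) ^ 2 + 2 * x ^ 2 - 2 * isoProfile c ^ 2 := by
  have hk : ∀ b ∈ Icc 0 x, 0 ≤ -(isoProfile (c + b) * stdQuantile (c + b)) +
      isoProfile (c - b) * stdQuantile (c - b) + 2 * b - 2 * stdQuantile c ^ 2 * b := by
    intro b hb
    have := le_of_hasDerivAt_nonneg hb.1
      (f := fun t => -(isoProfile (c + t) * stdQuantile (c + t)) +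
        isoProfile (c - t) * stdQuantile (c - t) + 2 * t - 2 * stdQuantile c ^ 2 * t)
      (fun t ht => by
        obtain ⟨h2, h3⟩ := HasDerivAt.comp_symm_pair
          (fun y => hasDerivAt_isoProfile_mul_stdQuantile) h0 h1 ⟨ht.1, ht.2.trans hb.2⟩
        exact ((h2.fun_neg.add h3).add ((hasDerivAt_id t).const_mul 2)).sub
          ((hasDerivAt_id t).const_mul _))
      (fun t ht => by
        have := stdQuantile_sq_midpoint (c := c) (x := t) ht.1 (by linarith [ht.2, hb.2])
          (by linarith [ht.2, hb.2])
        linarith)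
    simpa using this
  have := le_of_hasDerivAt_nonneg hx
    (f := fun t => isoProfile (c + t) ^ 2 + isoProfile (c - t) ^ 2 + 2 * t ^ 2 -
      2 * stdQuantile c ^ 2 * t ^ 2)
    (fun t ht => by
      obtain ⟨h2, h3⟩ := HasDerivAt.comp_symm_pair
        (fun y => hasDerivAt_isoProfile_sq) h0 h1 ht
      exact ((h2.add h3).add ((hasDerivAt_pow 2 t).const_mul 2)).sub
        ((hasDerivAt_pow 2 t).const_mul _))
    (fun t ht => by
      have := hk t ht
      norm_num
      linarith)
  norm_num at this
  linarith

lemma abs_stdQuantile_add_le (hc : c ≤ 1 / 2) (hx : 0 ≤ x) (h0 : 0 < c - x) :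
    |stdQuantile (c + x)| ≤ |stdQuantile (c - x)| := by
  have hm : c - x ∈ Ioo (0 : ℝ) 1 := ⟨h0, by linarith⟩
  have hm' : 1 - (c - x) ∈ Ioo (0 : ℝ) 1 := ⟨by linarith, by linarith⟩
  have hp : c + x ∈ Ioo (0 : ℝ) 1 := ⟨by linarith, by linarith⟩
  have e1 := strictMonoOn_stdQuantile.monotoneOn hm hp (by linarith)
  have e2 := strictMonoOn_stdQuantile.monotoneOn hp hm' (by linarith)
  rw [stdQuantile_one_sub hm] at e2
  exact (abs_le.2 ⟨by linarith, e2⟩).trans (neg_le_abs _)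

lemma isoProfile_sq_first_difference (hc : c ≤ 1 / 2) (hx : 0 ≤ x) (h0 : 0 < c - x) :
    (isoProfile (c + x) ^ 2 - isoProfile (c - x) ^ 2) ^ 2 ≤
      16 * isoProfile c ^ 2 * stdQuantile c ^ 2 * x ^ 2 := by
  have h1 : c + x < 1 := by linarith
  have hk : ∀ b ∈ Icc 0 x, 0 ≤ isoProfile (c + b) * stdQuantile (c + b) +
      isoProfile (c - b) * stdQuantile (c - b) - 2 * (isoProfile c * stdQuantile c) := by
    intro b hb
    have := le_of_hasDerivAt_nonneg hb.1
      (f := fun t => isoProfile (c + t) * stdQuantile (c + t) +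
        isoProfile (c - t) * stdQuantile (c - t))
      (fun t ht => by
        obtain ⟨h2, h3⟩ := HasDerivAt.comp_symm_pair
          (fun y => hasDerivAt_isoProfile_mul_stdQuantile) h0 h1 ⟨ht.1, ht.2.trans hb.2⟩
        exact h2.add h3)
      (fun t ht => by
        have := sq_le_sq.2 (abs_stdQuantile_add_le hc ht.1 (by linarith [ht.2, hb.2]))
        linarith)
    simp only [add_zero, sub_zero] at this
    linarith
  have hle := le_of_hasDerivAt_nonneg hx
    (f := fun t => isoProfile (c - t) ^ 2 - isoProfile (c + t) ^ 2 -
      4 * (isoProfile c * stdQuantile c) * t)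
    (fun t ht => by
      obtain ⟨h2, h3⟩ := HasDerivAt.comp_symm_pair
        (fun y => hasDerivAt_isoProfile_sq) h0 h1 ht
      exact (h3.sub h2).sub ((hasDerivAt_id t).const_mul _))
    (fun t ht => by
      have := hk t ht
      linarith)
  have hge : isoProfile (c - x) ≤ isoProfile (c + x) :=
    stdDens_le_of_abs_le (abs_stdQuantile_add_le hc hx h0)
  have hge' : 0 ≤ isoProfile (c + x) ^ 2 - isoProfile (c - x) ^ 2 := by
    have := isoProfile_pos (c - x)
    nlinarith
  norm_num at hle
  calc _ ≤ (-(4 * (isoProfile c * stdQuantile c) * x)) ^ 2 := by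
        apply pow_le_pow_left₀ hge'
        linarith
    _ = _ := by ring

/-- **Bobkov's two-point inequality**. -/
lemma isoProfile_two_point_of_le (hc : c ≤ 1 / 2) (hx : 0 ≤ x) (h0 : 0 < c - x) :
    2 * isoProfile c ≤ √(isoProfile (c + x) ^ 2 + x ^ 2) + √(isoProfile (c - x) ^ 2 + x ^ 2) := by
  have h1 := isoProfile_sq_first_difference hc hx h0
  have h2 := isoProfile_sq_second_difference hx h0 (by linarith)
  have hc0 := isoProfile_pos c
  set a := isoProfile (c + x)
  set b := isoProfile (c - x)
  set i := isoProfile c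
  set z := stdQuantile c
  have hp : 0 ≤ a ^ 2 + x ^ 2 := by positivity
  have hq : 0 ≤ b ^ 2 + x ^ 2 := by positivity
  set P := a ^ 2 + x ^ 2 with hP
  set Q := b ^ 2 + x ^ 2 with hQ
  have h3 : (P - Q) ^ 2 ≤ 8 * i ^ 2 * (P + Q - 2 * i ^ 2) := by
    have : 16 * i ^ 2 * z ^ 2 * x ^ 2 ≤ 8 * i ^ 2 * (P + Q - 2 * i ^ 2) := by
      have := mul_le_mul_of_nonneg_left h2 (show 0 ≤ 8 * i ^ 2 by positivity)
      rw [hP, hQ]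
      linarith
    rw [hP, hQ] at *
    linarith
  have h4 : 4 * i ^ 2 - P - Q ≤ 2 * (√P * √Q) := by
    rw [← Real.sqrt_mul hp]
    by_cases hs : 4 * i ^ 2 - P - Q ≤ 0
    · exact hs.trans (by positivity)
    · have : (4 * i ^ 2 - P - Q) / 2 ≤ √(P * Q) := by
        apply Real.le_sqrt_of_sq_le
        nlinarith
      linarith
  refine abs_le_of_sq_le_sq' ?_ (by positivity) |>.2
  have e1 := Real.sq_sqrt hp
  have e2 := Real.sq_sqrt hq
  nlinarith

end TwoPoint

lemma isoProfile_two_point {a b : ℝ} (ha : a ∈ Ioo (0 : ℝ) 1) (hb : b ∈ Ioo (0 : ℝ) 1) :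
    isoProfile ((a + b) / 2) ≤ (√(isoProfile a ^ 2 + ((a - b) / 2) ^ 2) +
      √(isoProfile b ^ 2 + ((a - b) / 2) ^ 2)) / 2 := by
  have key : ∀ {a b : ℝ}, a ∈ Ioo (0 : ℝ) 1 → b ∈ Ioo (0 : ℝ) 1 → b ≤ a →
      isoProfile ((a + b) / 2) ≤ (√(isoProfile a ^ 2 + ((a - b) / 2) ^ 2) +
      √(isoProfile b ^ 2 + ((a - b) / 2) ^ 2)) / 2 := by
    intro a b ha hb hab
    rcases le_total ((a + b) / 2) (1 / 2) with h | h
    · have := isoProfile_two_point_of_le (c := (a + b) / 2) (x := (a - b) / 2) h (by linarith)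
        (by linarith [hb.1])
      rw [show (a + b) / 2 + (a - b) / 2 = a by ring,
        show (a + b) / 2 - (a - b) / 2 = b by ring] at this
      linarith
    · have := isoProfile_two_point_of_le (c := 1 - (a + b) / 2) (x := (a - b) / 2) (by linarith)
        (by linarith) (by linarith [ha.2])
      rw [show 1 - (a + b) / 2 + (a - b) / 2 = 1 - b by ring,
        show 1 - (a + b) / 2 - (a - b) / 2 = 1 - a by ring, isoProfile_one_sub ha,
        isoProfile_one_sub hb,
        isoProfile_one_sub ⟨by linarith [ha.1, hb.1], by linarith [ha.2, hb.2]⟩] at this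
      linarith
  rcases le_total b a with h | h
  · exact key ha hb h
  · have := key hb ha h
    rw [add_comm b a, show (b - a) / 2 = -((a - b) / 2) by ring, neg_sq, add_comm √_] at this
    exact this

/-- The point of the discrete cube obtained by flipping the `i`-th coordinate. -/
def cubeFlip {m : ℕ} (x : Fin m → Bool) (i : Fin m) : Fin m → Bool :=
  Function.update x i (!x i)

/-- The uniform average of a function over the discrete cube. -/
noncomputable def cubeAvg {m : ℕ} (f : (Fin m → Bool) → ℝ) : ℝ := (∑ x, f x) / 2 ^ m

lemma cubeAvg_mono {m : ℕ} {f g : (Fin m → Bool) → ℝ} (h : ∀ x, f x ≤ g x) :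
    cubeAvg f ≤ cubeAvg g := by
  unfold cubeAvg
  gcongr
  exact h _

lemma cubeAvg_add {m : ℕ} (f g : (Fin m → Bool) → ℝ) :
    cubeAvg (fun x => f x + g x) = cubeAvg f + cubeAvg g := by
  simp [cubeAvg, Finset.sum_add_distrib, add_div]

lemma cubeAvg_mul_left {m : ℕ} (c : ℝ) (f : (Fin m → Bool) → ℝ) :
    cubeAvg (fun x => c * f x) = c * cubeAvg f := by
  simp [cubeAvg, ← Finset.mul_sum, mul_div_assoc]

lemma cubeAvg_const {m : ℕ} (c : ℝ) : cubeAvg (fun _ : Fin m → Bool => c) = c := by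
  simp [cubeAvg]

lemma cubeAvg_lt {m : ℕ} {f g : (Fin m → Bool) → ℝ} (h : ∀ x, f x < g x) :
    cubeAvg f < cubeAvg g := by
  unfold cubeAvg
  gcongr
  · exact Finset.univ_nonempty
  · exact h _

lemma cubeAvg_mem_Ioo {m : ℕ} {f : (Fin m → Bool) → ℝ} (h : ∀ x, f x ∈ Ioo (0 : ℝ) 1) :
    cubeAvg f ∈ Ioo (0 : ℝ) 1 := by
  constructor
  · simpa [cubeAvg_const] using cubeAvg_lt (f := fun _ => 0) (fun x => (h x).1)
  · simpa [cubeAvg_const] using cubeAvg_lt (g := fun _ => 1) (fun x => (h x).2)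

lemma cubeAvg_succ {m : ℕ} (f : (Fin (m + 1) → Bool) → ℝ) :
    cubeAvg f = (cubeAvg (fun x => f (Fin.cons true x)) +
      cubeAvg (fun x => f (Fin.cons false x))) / 2 := by
  have : ∑ x, f x = ∑ y : Bool × (Fin m → Bool), f (Fin.cons y.1 y.2) :=
    (Fintype.sum_equiv (Fin.consEquiv fun _ => Bool) _ _ fun y => rfl).symm
  unfold cubeAvg
  rw [this, Fintype.sum_prod_type, Fintype.sum_bool, pow_succ]
  field_simp

lemma cubeFlip_cons_zero {m : ℕ} (b : Bool) (x : Fin m → Bool) :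
    cubeFlip (Fin.cons b x : Fin (m + 1) → Bool) 0 = Fin.cons (!b) x := by
  simp [cubeFlip, Fin.update_cons_zero]

lemma cubeFlip_cons_succ {m : ℕ} (b : Bool) (x : Fin m → Bool) (i : Fin m) :
    cubeFlip (Fin.cons b x : Fin (m + 1) → Bool) i.succ = Fin.cons b (cubeFlip x i) := by
  simp [cubeFlip, Fin.cons_update]

lemma sqrt_sq_add_sq_cubeAvg_le {m : ℕ} (f g : (Fin m → Bool) → ℝ) :
    √(cubeAvg f ^ 2 + cubeAvg g ^ 2) ≤ cubeAvg fun x => √(f x ^ 2 + g x ^ 2) := by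
  have h : ∀ a b : ℝ, √(a ^ 2 + b ^ 2) = ‖(⟨a, b⟩ : ℂ)‖ := by
    intro a b
    rw [Complex.norm_def, Complex.normSq_mk, sq, sq]
  have := norm_sum_le Finset.univ fun x => (⟨f x, g x⟩ : ℂ)
  have h2 : ∑ x, (⟨f x, g x⟩ : ℂ) = ⟨∑ x, f x, ∑ x, g x⟩ := by
    apply Complex.ext <;> simp
  simp_rw [h2, ← h] at this
  have h3 : (0 : ℝ) < 2 ^ m := by positivity
  unfold cubeAvg
  rw [div_pow, div_pow, ← add_div, Real.sqrt_div' _ (by positivity), Real.sqrt_sq h3.le]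
  gcongr

/-- **Bobkov's inequality on the discrete cube**. -/
lemma isoProfile_cubeAvg_le {m : ℕ} (f : (Fin m → Bool) → ℝ) (hf : ∀ x, f x ∈ Ioo (0 : ℝ) 1) :
    isoProfile (cubeAvg f) ≤
      cubeAvg fun x => √(isoProfile (f x) ^ 2 + ∑ i, ((f x - f (cubeFlip x i)) / 2) ^ 2) := by
  induction m with
  | zero => simp [cubeAvg, Real.sqrt_sq (isoProfile_pos _).le]
  | succ m ih =>
    have key : ∀ b : Bool, √(isoProfile (cubeAvg fun x => f (Fin.cons b x)) ^ 2 +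
        ((cubeAvg (fun x => f (Fin.cons true x)) - cubeAvg (fun x => f (Fin.cons false x))) / 2) ^ 2)
        ≤ cubeAvg fun x => √(isoProfile (f (Fin.cons b x)) ^ 2 +
          ∑ i, ((f (Fin.cons b x) - f (cubeFlip (Fin.cons b x : Fin (m + 1) → Bool) i)) / 2) ^ 2) := by
      intro b
      have h1 := ih (fun x => f (Fin.cons b x)) fun x => hf _
      have h2 : (cubeAvg (fun x => f (Fin.cons true x)) -
          cubeAvg (fun x => f (Fin.cons false x))) / 2 =
          cubeAvg fun x => (f (Fin.cons true x) - f (Fin.cons false x)) / 2 := by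
        simp only [cubeAvg, ← Finset.sum_div, Finset.sum_sub_distrib]
        ring
      calc _ ≤ √((cubeAvg fun x => √(isoProfile (f (Fin.cons b x)) ^ 2 +
              ∑ i, ((f (Fin.cons b x) - f (Fin.cons b (cubeFlip x i))) / 2) ^ 2)) ^ 2 +
              (cubeAvg fun x => (f (Fin.cons true x) - f (Fin.cons false x)) / 2) ^ 2) := by
            rw [h2]
            have := (isoProfile_pos (cubeAvg fun x => f (Fin.cons b x))).le
            gcongr
        _ ≤ _ := sqrt_sq_add_sq_cubeAvg_le _ _
        _ ≤ _ := by
            refine cubeAvg_mono fun x => Real.sqrt_le_sqrt ?_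
            rw [Real.sq_sqrt (by positivity), Fin.sum_univ_succ, cubeFlip_cons_zero]
            simp_rw [cubeFlip_cons_succ]
            cases b <;> simp only [Bool.not_true, Bool.not_false] <;> linarith
    rw [cubeAvg_succ f]
    refine (isoProfile_two_point (cubeAvg_mem_Ioo fun x => hf _)
      (cubeAvg_mem_Ioo fun x => hf _)).trans ?_
    rw [cubeAvg_succ]
    linarith [key true, key false]

/-- The sign `±1` encoded by a Boolean. -/
def boolSign (b : Bool) : ℝ := if b then 1 else -1

/-- The signed sum of the vectors `v k`, with signs given by a point of the discrete cube. -/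
def cubeWalk {E : Type*} [AddCommGroup E] [Module ℝ E] {m : ℕ} (v : Fin m → E) (x : Fin m → Bool) :
    E := ∑ k, boolSign (x k) • v k

lemma cubeWalk_cubeFlip {E : Type*} [AddCommGroup E] [Module ℝ E] {m : ℕ} (v : Fin m → E)
    (x : Fin m → Bool) (k : Fin m) :
    cubeWalk v (cubeFlip x k) = cubeWalk v x + (-2 * boolSign (x k)) • v k := by
  unfold cubeWalk
  rw [← sub_eq_iff_eq_add', ← Finset.sum_sub_distrib, Finset.sum_eq_single k]
  · rw [← sub_smul]
    congr 1
    cases h : x k <;> simp [cubeFlip, boolSign, h] <;> norm_num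
  · intro j _ hj
    simp [cubeFlip, hj]
  · simp

/-- The uniform measure on the discrete cube. -/
noncomputable def cubeMeasure (m : ℕ) : Measure (Fin m → Bool) :=
  (PMF.uniformOfFintype (Fin m → Bool)).toMeasure

instance (m : ℕ) : IsProbabilityMeasure (cubeMeasure m) := PMF.toMeasure.isProbabilityMeasure _

lemma integral_cubeMeasure {F : Type*} [NormedAddCommGroup F] [NormedSpace ℝ F] [CompleteSpace F]
    {m : ℕ} (f : (Fin m → Bool) → F) :
    ∫ x, f x ∂(cubeMeasure m) = ((2 : ℝ) ^ m)⁻¹ • ∑ x, f x := by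
  rw [cubeMeasure, PMF.integral_eq_sum, Finset.smul_sum]
  simp

lemma integral_cubeMeasure_eq_cubeAvg {m : ℕ} (f : (Fin m → Bool) → ℝ) :
    ∫ x, f x ∂(cubeMeasure m) = cubeAvg f := by
  rw [integral_cubeMeasure, cubeAvg, smul_eq_mul, div_eq_inv_mul]

lemma charFun_map_cubeWalk {E : Type*} [NormedAddCommGroup E] [InnerProductSpace ℝ E]
    [MeasurableSpace E] [BorelSpace E] [SecondCountableTopology E] {m : ℕ} (v : Fin m → E) (t : E) :
    charFun ((cubeMeasure m).map (cubeWalk v)) t = ∏ k, (Real.cos (inner ℝ (v k) t) : ℂ) := by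
  rw [charFun_apply, integral_map (measurable_of_finite _).aemeasurable (by fun_prop),
    integral_cubeMeasure]
  have h : ∀ x : Fin m → Bool, Complex.exp (inner ℝ (cubeWalk v x) t * Complex.I) =
      ∏ k, Complex.exp (boolSign (x k) * inner ℝ (v k) t * Complex.I) := by
    intro x
    rw [← Complex.exp_sum, cubeWalk, sum_inner, Complex.ofReal_sum, Finset.sum_mul]
    simp [real_inner_smul_left]
  simp_rw [h]
  have h2 := Finset.prod_univ_sum (fun _ : Fin m => (Finset.univ : Finset Bool))
    (fun k b => Complex.exp (boolSign b * inner ℝ (v k) t * Complex.I))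
  rw [Fintype.piFinset_univ] at h2
  rw [← h2]
  simp_rw [Fintype.sum_bool]
  have h3 : ((2 : ℝ) ^ m)⁻¹ = ∏ _k : Fin m, (2 : ℝ)⁻¹ := by simp
  rw [h3, Complex.real_smul, Complex.ofReal_prod, ← Finset.prod_mul_distrib]
  refine Finset.prod_congr rfl fun k _ => ?_
  rw [Complex.ofReal_cos, Complex.cos]
  simp [boolSign]
  ring

/-- The steps of the normalized simple random walk with `N` steps along each coordinate axis. -/
noncomputable def axisSteps (n N : ℕ) (k : Fin (n * N)) : EuclideanSpace ℝ (Fin n) :=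
  EuclideanSpace.single (finProdFinEquiv.symm k).1 (√N)⁻¹

lemma prod_axisSteps {R : Type*} [CommMonoid R] {n N : ℕ} (g : Fin n → R) :
    ∏ k : Fin (n * N), g (finProdFinEquiv.symm k).1 = ∏ i, g i ^ N := by
  rw [← Equiv.prod_comp finProdFinEquiv]
  simp [Fintype.prod_prod_type]

lemma inner_axisSteps {n N : ℕ} (k : Fin (n * N)) (t : EuclideanSpace ℝ (Fin n)) :
    inner ℝ (axisSteps n N k) t = (√N)⁻¹ * t (finProdFinEquiv.symm k).1 := by
  simp [axisSteps, EuclideanSpace.inner_single_left]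

lemma norm_axisSteps {n N : ℕ} (k : Fin (n * N)) : ‖axisSteps n N k‖ = (√N)⁻¹ := by
  simp [axisSteps]

lemma tendsto_cos_pow (t : ℝ) :
    Tendsto (fun N : ℕ => (Real.cos ((√N)⁻¹ * t) : ℂ) ^ N) atTop (𝓝 (Complex.exp (-t ^ 2 / 2))) := by
  have hi : ∀ f : (Fin 1 → Bool) → ℝ,
      ∫ x, f x ∂(cubeMeasure 1) = (f (fun _ => true) + f fun _ => false) / 2 := by
    intro f
    rw [integral_cubeMeasure_eq_cubeAvg, cubeAvg,
      ← Equiv.sum_comp (Equiv.funUnique (Fin 1) Bool).symm, Fintype.sum_bool]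
    simp; rfl
  have h := tendsto_charFun_inv_sqrt_mul_pow (P := cubeMeasure 1)
    (X := cubeWalk fun _ => (1 : ℝ)) (measurable_of_finite _).aemeasurable
    (by rw [hi]; simp [cubeWalk, boolSign]) (by rw [hi]; simp [cubeWalk, boolSign]) t
  simpa [charFun_map_cubeWalk] using h

theorem tendsto_cubeAvg_stdGaussian {n : ℕ} {g : EuclideanSpace ℝ (Fin n) → ℝ} (hg : Continuous g)
    {C : ℝ} (hC : ∀ z, |g z| ≤ C) :
    Tendsto (fun N : ℕ => cubeAvg fun x => g (cubeWalk (axisSteps n N) x)) atTop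
      (𝓝 (∫ z, g z ∂(stdGaussian (EuclideanSpace ℝ (Fin n))))) := by
  let μ : ℕ → ProbabilityMeasure (EuclideanSpace ℝ (Fin n)) := fun N =>
    ⟨(cubeMeasure (n * N)).map (cubeWalk (axisSteps n N)),
      Measure.isProbabilityMeasure_map (measurable_of_finite _).aemeasurable⟩
  let μ₀ : ProbabilityMeasure (EuclideanSpace ℝ (Fin n)) := ⟨stdGaussian _, inferInstance⟩
  have hμ : Tendsto μ atTop (𝓝 μ₀) := by
    refine ProbabilityMeasure.tendsto_of_tendsto_charFun fun t => ?_
    simp only [μ, μ₀, ProbabilityMeasure.coe_mk, charFun_map_cubeWalk, charFun_stdGaussian,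
      inner_axisSteps]
    have h1 : ∀ N : ℕ, ∏ k : Fin (n * N),
        (Real.cos ((√N)⁻¹ * t (finProdFinEquiv.symm k).1) : ℂ) =
        ∏ i, (Real.cos ((√N)⁻¹ * t i) : ℂ) ^ N := fun N =>
      prod_axisSteps fun i => (Real.cos ((√N)⁻¹ * t i) : ℂ)
    simp_rw [h1]
    have h2 : Complex.exp (-(‖t‖ : ℂ) ^ 2 / 2) = ∏ i, Complex.exp (-(t i : ℂ) ^ 2 / 2) := by
      rw [← Complex.exp_sum, ← Complex.ofReal_pow, EuclideanSpace.real_norm_sq_eq]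
      push_cast
      rw [← Finset.sum_neg_distrib, Finset.sum_div]
    rw [h2]
    exact tendsto_finsetProd _ fun i _ => tendsto_cos_pow (t i)
  rw [ProbabilityMeasure.tendsto_iff_forall_integral_tendsto] at hμ
  have := hμ (BoundedContinuousFunction.ofNormedAddCommGroup g hg C hC)
  refine this.congr fun N => ?_
  simp only [μ, ProbabilityMeasure.coe_mk, BoundedContinuousFunction.coe_ofNormedAddCommGroup]
  rw [integral_map (measurable_of_finite _).aemeasurable hg.aestronglyMeasurable,
    integral_cubeMeasure_eq_cubeAvg]

/-- `h` has at every point a gradient of norm at most `L`, with a uniform quadratic error. -/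
def HasQuadraticExpansion {E : Type*} [NormedAddCommGroup E] [InnerProductSpace ℝ E] (L K : ℝ)
    (h : E → ℝ) : Prop :=
  ∀ z, ∃ w, ‖w‖ ≤ L ∧ ∀ v, |h (z + v) - h z - inner ℝ w v| ≤ K * ‖v‖ ^ 2

lemma HasQuadraticExpansion.continuous {E : Type*} [NormedAddCommGroup E] [InnerProductSpace ℝ E]
    {L K : ℝ} {h : E → ℝ} (hh : HasQuadraticExpansion L K h) : Continuous h := by
  refine continuous_iff_continuousAt.2 fun z => ?_
  obtain ⟨w, -, hw⟩ := hh z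
  rw [ContinuousAt, tendsto_iff_norm_sub_tendsto_zero]
  have hb : ∀ y, ‖h y - h z‖ ≤ |inner ℝ w (y - z)| + K * ‖y - z‖ ^ 2 := by
    intro y
    have := hw (y - z)
    rw [add_sub_cancel] at this
    rw [Real.norm_eq_abs]
    calc |h y - h z| = |(h y - h z - inner ℝ w (y - z)) + inner ℝ w (y - z)| := by ring_nf
      _ ≤ _ := (abs_add_le _ _).trans (by linarith)
  refine squeeze_zero (fun _ => norm_nonneg _) hb ?_
  have : Continuous fun y => |inner ℝ w (y - z)| + K * ‖y - z‖ ^ 2 := by fun_prop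
  simpa using this.tendsto z

lemma HasQuadraticExpansion.const_sub_div {E : Type*} [NormedAddCommGroup E]
    [InnerProductSpace ℝ E] {L K : ℝ} {h : E → ℝ} (hh : HasQuadraticExpansion L K h) (s : ℝ)
    {ε : ℝ} (hε : 0 < ε) :
    HasQuadraticExpansion (L / ε) (K / ε) (fun z => (s - h z) / ε) := by
  intro z
  obtain ⟨w, hw1, hw2⟩ := hh z
  refine ⟨-(ε⁻¹ • w), ?_, fun v => ?_⟩
  · rw [norm_neg, norm_smul, Real.norm_of_nonneg (by positivity), div_eq_inv_mul]
    gcongr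
  · have h1 : (s - h (z + v)) / ε - (s - h z) / ε - inner ℝ (-(ε⁻¹ • w)) v =
        -((h (z + v) - h z - inner ℝ w v) / ε) := by
      rw [inner_neg_left, real_inner_smul_left]; ring
    rw [h1, abs_neg, abs_div, abs_of_pos hε, div_mul_eq_mul_div]
    gcongr
    exact hw2 v

lemma sum_inner_axisSteps_sq {n N : ℕ} (hN : N ≠ 0) (w : EuclideanSpace ℝ (Fin n)) :
    ∑ k, inner ℝ w (axisSteps n N k) ^ 2 = ‖w‖ ^ 2 := by
  have h : ∀ k, inner ℝ w (axisSteps n N k) = (√N)⁻¹ * w (finProdFinEquiv.symm k).1 := fun k => by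
    rw [real_inner_comm, inner_axisSteps]
  simp_rw [h]
  rw [← Equiv.sum_comp finProdFinEquiv]
  simp only [Equiv.symm_apply_apply, Fintype.sum_prod_type, Finset.sum_const, Finset.card_univ,
    Fintype.card_fin, mul_pow, inv_pow, EuclideanSpace.real_norm_sq_eq]
  refine Finset.sum_congr rfl fun i _ => ?_
  rw [Real.sq_sqrt (by positivity)]
  have : (N : ℝ) ≠ 0 := by exact_mod_cast hN
  rw [nsmul_eq_mul]
  field_simp

lemma abs_stdPhi_sub_le {E : Type*} [NormedAddCommGroup E] [InnerProductSpace ℝ E]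
    {K L : ℝ} {k : E → ℝ} {z w : E} (hL : ‖w‖ ≤ L)
    (hw : ∀ v, |k (z + v) - k z - inner ℝ w v| ≤ K * ‖v‖ ^ 2) {v : E} {r : ℝ}
    (hv : ‖v‖ ≤ r) (hr : r ≤ 2) (hK : 0 ≤ K) :
    |stdPhi (k (z + v)) - stdPhi (k z)| ≤
      stdDens (k z) * |inner ℝ w v| + (K + (L + 2 * K) ^ 2) * r ^ 2 := by
  have h1 := abs_stdPhi_taylor (k z) (k (z + v))
  set a := k (z + v) - k z with ha
  have h0 : 0 ≤ ‖v‖ := norm_nonneg v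
  have h2 : |a - inner ℝ w v| ≤ K * r ^ 2 := (hw v).trans (by gcongr)
  have h3 : |a| ≤ (L + 2 * K) * r := by
    calc |a| = |(a - inner ℝ w v) + inner ℝ w v| := by ring_nf
      _ ≤ |a - inner ℝ w v| + |inner ℝ w v| := abs_add_le _ _
      _ ≤ K * r ^ 2 + L * r := by
          gcongr
          exact (abs_real_inner_le_norm w v).trans
            (mul_le_mul hL hv h0 ((norm_nonneg w).trans hL))
      _ ≤ (L + 2 * K) * r := by nlinarith [mul_nonneg hK (h0.trans hv)]
  have h4 : a ^ 2 ≤ (L + 2 * K) ^ 2 * r ^ 2 := by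
    rw [← sq_abs, ← mul_pow]; gcongr
  have hd := stdDens_le_one (k z)
  have hd0 := stdDens_pos (k z)
  calc _ = |(stdPhi (k (z + v)) - stdPhi (k z) - stdDens (k z) * a) +
        stdDens (k z) * (a - inner ℝ w v) + stdDens (k z) * inner ℝ w v| := by ring_nf
    _ ≤ _ := abs_add_three _ _ _
    _ ≤ (L + 2 * K) ^ 2 * r ^ 2 + 1 * (K * r ^ 2) + stdDens (k z) * |inner ℝ w v| := by
        rw [abs_mul, abs_mul, abs_of_pos hd0]
        gcongr
        exact h1.trans h4
    _ = _ := by ring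

lemma isoProfile_cubeAvg_walk_le {n : ℕ} {L K : ℝ} {k : EuclideanSpace ℝ (Fin n) → ℝ}
    (hk : HasQuadraticExpansion L K k) (hL : 0 ≤ L) (hK : 0 ≤ K) :
    ∃ C : ℝ, ∀ N : ℕ, N ≠ 0 →
      isoProfile (cubeAvg fun x => stdPhi (k (cubeWalk (axisSteps n N) x))) ≤
        √(1 + L ^ 2) * cubeAvg (fun x => stdDens (k (cubeWalk (axisSteps n N) x))) +
          √(C * (√N)⁻¹) := by
  set D : ℝ := 2 * (K + (L + 2 * K) ^ 2) with hD
  have hD0 : 0 ≤ D := by positivity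
  refine ⟨n * (2 * D * L + D ^ 2), fun N hN => ?_⟩
  refine (isoProfile_cubeAvg_le _ fun x => stdPhi_mem_Ioo _).trans ?_
  rw [← cubeAvg_mul_left, ← cubeAvg_const (m := n * N) √(n * (2 * D * L + D ^ 2) * (√N)⁻¹), ← cubeAvg_add]
  refine cubeAvg_mono fun x => ?_
  set z := cubeWalk (axisSteps n N) x with hz
  obtain ⟨w, hwL, hw⟩ := hk z
  have hN1 : (1 : ℝ) ≤ √N := by
    rw [Real.one_le_sqrt]; exact_mod_cast Nat.one_le_iff_ne_zero.2 hN
  set r := (√(N : ℝ))⁻¹ with hr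
  have hr0 : 0 ≤ r := by positivity
  have hr1 : r ≤ 1 := inv_le_one_of_one_le₀ hN1
  have hrN : (N : ℝ) * r ^ 2 = 1 := by
    rw [hr, inv_pow, Real.sq_sqrt (by positivity)]
    exact mul_inv_cancel₀ (by exact_mod_cast hN)
  have hd := stdDens_le_one (k z)
  have hd0 := stdDens_pos (k z)
  have hstep : ∀ i, ((stdPhi (k z) - stdPhi (k (cubeWalk (axisSteps n N) (cubeFlip x i)))) / 2) ^ 2
      ≤ stdDens (k z) ^ 2 * inner ℝ w (axisSteps n N i) ^ 2 + (2 * D * L + D ^ 2) * r ^ 3 := by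
    intro i
    rw [cubeWalk_cubeFlip, ← hz]
    set v := axisSteps n N i with hv
    have hvr : ‖v‖ = r := norm_axisSteps i
    have hb : |-2 * boolSign (x i)| = 2 := by
      unfold boolSign; split_ifs <;> norm_num
    have h1 := abs_stdPhi_sub_le hwL hw (v := (-2 * boolSign (x i)) • v) (r := 2 * r)
      (by rw [norm_smul, Real.norm_eq_abs, hb, hvr]) (by linarith) hK
    rw [real_inner_smul_right, abs_mul, hb] at h1
    set t := |inner ℝ w v| with ht
    have ht0 : 0 ≤ t := abs_nonneg _
    have htL : t ≤ L * r := (abs_real_inner_le_norm w v).trans (by rw [hvr]; gcongr)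
    have h2 : |(stdPhi (k z) - stdPhi (k (z + (-2 * boolSign (x i)) • v))) / 2| ≤
        stdDens (k z) * t + D * r ^ 2 := by
      rw [abs_div, abs_sub_comm, abs_of_pos (zero_lt_two' ℝ), div_le_iff₀ two_pos]
      refine h1.trans (le_of_eq ?_)
      rw [hD]; ring
    have h3 : stdDens (k z) * t ≤ L * r := by nlinarith
    calc _ = |(stdPhi (k z) - stdPhi (k (z + (-2 * boolSign (x i)) • v))) / 2| ^ 2 :=
          (sq_abs _).symm
      _ ≤ (stdDens (k z) * t + D * r ^ 2) ^ 2 := by gcongr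
      _ = stdDens (k z) ^ 2 * t ^ 2 + (2 * D * r ^ 2 * (stdDens (k z) * t) + D ^ 2 * r ^ 3 * r) := by
          ring
      _ ≤ stdDens (k z) ^ 2 * t ^ 2 + (2 * D * r ^ 2 * (L * r) + D ^ 2 * r ^ 3 * 1) := by gcongr
      _ = _ := by rw [ht, sq_abs]; ring
  rw [isoProfile_stdPhi]
  calc _ ≤ √(stdDens (k z) ^ 2 + ∑ i, (stdDens (k z) ^ 2 * inner ℝ w (axisSteps n N i) ^ 2 +
        (2 * D * L + D ^ 2) * r ^ 3)) := by
        gcongr with i _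
        exact hstep i
    _ ≤ √((√(1 + L ^ 2) * stdDens (k z)) ^ 2 + n * (2 * D * L + D ^ 2) * r) := by
        refine Real.sqrt_le_sqrt ?_
        rw [Finset.sum_add_distrib, ← Finset.mul_sum, sum_inner_axisSteps_sq hN, Finset.sum_const,
          Finset.card_univ, Fintype.card_fin, nsmul_eq_mul, mul_pow √(1 + L ^ 2),
            Real.sq_sqrt (by positivity)]
        push_cast
        have e : (n : ℝ) * N * ((2 * D * L + D ^ 2) * r ^ 3) =
            n * (2 * D * L + D ^ 2) * r * (N * r ^ 2) := by ring
        rw [e, hrN]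
        have : ‖w‖ ^ 2 ≤ L ^ 2 := by gcongr
        nlinarith [mul_le_mul_of_nonneg_left this (sq_nonneg (stdDens (k z)))]
    _ ≤ _ := by
        refine Real.sqrt_le_iff.2 ⟨by positivity, ?_⟩
        rw [add_sq, Real.sq_sqrt (by positivity)]
        have : 0 ≤ 2 * (√(1 + L ^ 2) * stdDens (k z)) * √(n * (2 * D * L + D ^ 2) * r) := by positivity
        linarith

lemma integrable_stdPhi_comp {n : ℕ} {k : EuclideanSpace ℝ (Fin n) → ℝ} (hk : Continuous k) :
    Integrable (fun z => stdPhi (k z)) (stdGaussian (EuclideanSpace ℝ (Fin n))) :=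
  Integrable.of_bound (continuous_stdPhi.comp hk).aestronglyMeasurable 1
    (ae_of_all _ fun z => by
      rw [Real.norm_of_nonneg (stdPhi_pos _).le]; exact (stdPhi_lt_one _).le)

lemma integrable_stdDens_comp {n : ℕ} {k : EuclideanSpace ℝ (Fin n) → ℝ} (hk : Continuous k) :
    Integrable (fun z => stdDens (k z)) (stdGaussian (EuclideanSpace ℝ (Fin n))) :=
  Integrable.of_bound (continuous_stdDens.comp hk).aestronglyMeasurable 1
    (ae_of_all _ fun z => by
      rw [Real.norm_of_nonneg (stdDens_pos _).le]; exact stdDens_le_one _)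

lemma integral_stdPhi_mem_Ioo {n : ℕ} {k : EuclideanSpace ℝ (Fin n) → ℝ} (hk : Continuous k) :
    ∫ z, stdPhi (k z) ∂(stdGaussian (EuclideanSpace ℝ (Fin n))) ∈ Ioo (0 : ℝ) 1 := by
  have hi := integrable_stdPhi_comp hk
  have h1 : ∀ g : EuclideanSpace ℝ (Fin n) → ℝ, Integrable g (stdGaussian _) → (∀ z, 0 < g z) →
      0 < ∫ z, g z ∂(stdGaussian (EuclideanSpace ℝ (Fin n))) := by
    intro g hg h0
    rw [integral_pos_iff_support_of_nonneg (fun z => (h0 z).le) hg,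
      show Function.support g = univ from eq_univ_of_forall fun z => (h0 z).ne']
    simp
  refine ⟨h1 _ hi fun z => stdPhi_pos _, ?_⟩
  have h2 := h1 _ ((integrable_const (1 : ℝ)).sub hi) fun z => sub_pos.2 (stdPhi_lt_one (k z))
  simp only [Pi.sub_apply] at h2
  rw [integral_sub (integrable_const _) hi] at h2
  simpa using h2

/-- A form of Bobkov's functional isoperimetric inequality. -/
theorem isoProfile_integral_stdPhi_le {n : ℕ} {L K : ℝ} {k : EuclideanSpace ℝ (Fin n) → ℝ}
    (hk : HasQuadraticExpansion L K k) (hL : 0 ≤ L) (hK : 0 ≤ K) :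
    isoProfile (∫ z, stdPhi (k z) ∂(stdGaussian (EuclideanSpace ℝ (Fin n)))) ≤
      √(1 + L ^ 2) * ∫ z, stdDens (k z) ∂(stdGaussian (EuclideanSpace ℝ (Fin n))) := by
  obtain ⟨C, hC⟩ := isoProfile_cubeAvg_walk_le hk hL hK
  have h1 := tendsto_cubeAvg_stdGaussian (continuous_stdPhi.comp hk.continuous) (C := 1)
    fun z => by
      simp only [Function.comp_apply]
      rw [abs_of_pos (stdPhi_pos _)]; exact (stdPhi_lt_one _).le
  have h2 := tendsto_cubeAvg_stdGaussian (continuous_stdDens.comp hk.continuous) (C := 1)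
    fun z => by
      simp only [Function.comp_apply]
      rw [abs_of_pos (stdDens_pos _)]; exact stdDens_le_one _
  have h3 : Tendsto (fun N : ℕ => √(C * (√(N : ℝ))⁻¹)) atTop (𝓝 0) := by
    have : Tendsto (fun N : ℕ => (√(N : ℝ))⁻¹) atTop (𝓝 0) :=
      (Real.tendsto_sqrt_atTop.comp tendsto_natCast_atTop_atTop).inv_tendsto_atTop
    simpa using (this.const_mul C).sqrt
  have h4 := (hasDerivAt_isoProfile (integral_stdPhi_mem_Ioo hk.continuous)).continuousAt.tendsto.comp
    h1
  have h5 := (h2.const_mul √(1 + L ^ 2)).add h3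
  rw [add_zero] at h5
  refine le_of_tendsto_of_tendsto h4 h5 ?_
  filter_upwards [eventually_ne_atTop 0] with N hN using hC N hN

lemma hasDerivAt_integral_stdPhi {n : ℕ} {h : EuclideanSpace ℝ (Fin n) → ℝ} (hh : Continuous h)
    {ε : ℝ} (hε : 0 < ε) (s : ℝ) :
    HasDerivAt (fun s => ∫ z, stdPhi ((s - h z) / ε) ∂(stdGaussian (EuclideanSpace ℝ (Fin n))))
      ((∫ z, stdDens ((s - h z) / ε) ∂(stdGaussian (EuclideanSpace ℝ (Fin n)))) / ε) s := by
  have h1 := hasDerivAt_integral_of_dominated_loc_of_deriv_le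
    (μ := stdGaussian (EuclideanSpace ℝ (Fin n))) (s := univ) (x₀ := s)
    (F := fun s z => stdPhi ((s - h z) / ε)) (F' := fun s z => stdDens ((s - h z) / ε) / ε)
    (bound := fun _ => 1 / ε) univ_mem
    (Eventually.of_forall fun x => (integrable_stdPhi_comp (by fun_prop)).aestronglyMeasurable)
    (integrable_stdPhi_comp (by fun_prop))
    ((integrable_stdDens_comp (by fun_prop)).div_const _).aestronglyMeasurable
    (ae_of_all _ fun z x _ => by
      rw [norm_div, Real.norm_of_nonneg (stdDens_pos _).le, Real.norm_of_nonneg hε.le]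
      gcongr
      exact stdDens_le_one _)
    (integrable_const _)
    (ae_of_all _ fun z x _ => by
      have := (hasDerivAt_stdPhi ((x - h z) / ε)).comp x
        (((hasDerivAt_id x).sub_const (h z)).div_const ε)
      simpa [Function.comp_def, div_eq_mul_inv] using this)
  have h2 := h1.2
  rwa [integral_div] at h2

lemma stdQuantile_integral_stdPhi_add_le {n : ℕ} {K : ℝ} {h : EuclideanSpace ℝ (Fin n) → ℝ}
    (hh : HasQuadraticExpansion 1 K h) (hK : 0 ≤ K) {ε : ℝ} (hε : 0 < ε) {s t : ℝ} (hst : s ≤ t) :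
    stdQuantile (∫ z, stdPhi ((s - h z) / ε) ∂(stdGaussian (EuclideanSpace ℝ (Fin n)))) +
        (t - s) / √(1 + ε ^ 2) ≤
      stdQuantile (∫ z, stdPhi ((t - h z) / ε) ∂(stdGaussian (EuclideanSpace ℝ (Fin n)))) := by
  have hc := hh.continuous
  set p : ℝ → ℝ := fun s => ∫ z, stdPhi ((s - h z) / ε) ∂(stdGaussian (EuclideanSpace ℝ (Fin n)))
    with hp
  set d : ℝ → ℝ := fun s => ∫ z, stdDens ((s - h z) / ε) ∂(stdGaussian (EuclideanSpace ℝ (Fin n)))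
    with hd
  have hp1 : ∀ r, p r ∈ Ioo (0 : ℝ) 1 := fun r => integral_stdPhi_mem_Ioo (by fun_prop)
  have hder : ∀ r ∈ Icc s t, HasDerivAt (fun r => stdQuantile (p r) - r / √(1 + ε ^ 2))
      ((isoProfile (p r))⁻¹ * (d r / ε) - 1 / √(1 + ε ^ 2)) r := fun r _ =>
    ((hasDerivAt_stdQuantile (hp1 r)).comp r (hasDerivAt_integral_stdPhi hc hε r)).sub
      ((hasDerivAt_id r).div_const _)
  have hnn : ∀ r ∈ Icc s t, 0 ≤ (isoProfile (p r))⁻¹ * (d r / ε) - 1 / √(1 + ε ^ 2) := by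
    intro r _
    have h1 : isoProfile (p r) ≤ √(1 + (1 / ε) ^ 2) * d r :=
      isoProfile_integral_stdPhi_le (hh.const_sub_div r hε) (by positivity) (by positivity)
    have h2 : √(1 + (1 / ε) ^ 2) = √(1 + ε ^ 2) / ε := by
      rw [show 1 + (1 / ε) ^ 2 = (1 + ε ^ 2) / ε ^ 2 by field_simp; ring, Real.sqrt_div (by positivity),
        Real.sqrt_sq hε.le]
    have h3 := isoProfile_pos (p r)
    have h4 : 0 < √(1 + ε ^ 2) := by positivity
    rw [sub_nonneg, div_le_iff₀ h4, inv_mul_eq_div, div_mul_eq_mul_div, le_div_iff₀ h3, one_mul]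
    refine h1.trans (le_of_eq ?_)
    rw [h2]; ring
  have := le_of_hasDerivAt_nonneg hst hder hnn
  rw [sub_div]
  linarith

lemma stdPhi_sub_le_measureReal {n : ℕ} {K : ℝ} {h : EuclideanSpace ℝ (Fin n) → ℝ}
    (hh : HasQuadraticExpansion 1 K h) (hK : 0 ≤ K) {a s t b : ℝ} (has : a < s) (hst : s ≤ t)
    (htb : t < b) (ha : 1 / 2 ≤ (stdGaussian (EuclideanSpace ℝ (Fin n))).real {z | h z ≤ a}) :
    stdPhi (t - s) ≤ (stdGaussian (EuclideanSpace ℝ (Fin n))).real {z | h z ≤ b} := by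
  have hc := hh.continuous
  set γ := stdGaussian (EuclideanSpace ℝ (Fin n)) with hγ
  have hma : ∀ a, MeasurableSet {z | h z ≤ a} := fun a => measurableSet_le hc.measurable measurable_const
  have key : ∀ ε > 0, stdPhi (stdQuantile (stdPhi ((s - a) / ε) * (1 / 2)) + (t - s) / √(1 + ε ^ 2)) ≤
      γ.real {z | h z ≤ b} + stdPhi ((t - b) / ε) := by
    intro ε hε
    have h1 : stdPhi ((s - a) / ε) * (1 / 2) ≤ ∫ z, stdPhi ((s - h z) / ε) ∂γ := by
      have hi : Integrable ({z | h z ≤ a}.indicator fun _ => stdPhi ((s - a) / ε)) γ :=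
        (integrable_const _).indicator (hma a)
      calc _ ≤ stdPhi ((s - a) / ε) * γ.real {z | h z ≤ a} := by
            have := stdPhi_pos ((s - a) / ε)
            gcongr
        _ = ∫ z, {z | h z ≤ a}.indicator (fun _ => stdPhi ((s - a) / ε)) z ∂γ := by
            rw [integral_indicator (hma a), setIntegral_const, smul_eq_mul, mul_comm]
        _ ≤ _ := by
            refine integral_mono hi (integrable_stdPhi_comp (by fun_prop)) fun z => ?_
            by_cases hz : z ∈ {z | h z ≤ a}
            · rw [indicator_of_mem hz]
              refine strictMono_stdPhi.monotone ?_
              simp only [mem_ofPred_eq] at hz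
              gcongr
            · rw [indicator_of_notMem hz]; exact (stdPhi_pos _).le
    have h2 : ∫ z, stdPhi ((t - h z) / ε) ∂γ ≤ γ.real {z | h z ≤ b} + stdPhi ((t - b) / ε) := by
      have hi : Integrable ({z | h z ≤ b}.indicator fun _ => (1 : ℝ)) γ :=
        (integrable_const _).indicator (hma b)
      calc _ ≤ ∫ z, ({z | h z ≤ b}.indicator (fun _ => (1 : ℝ)) z + stdPhi ((t - b) / ε)) ∂γ := by
            refine integral_mono (integrable_stdPhi_comp (by fun_prop))
              (hi.add (integrable_const _)) fun z => ?_
            by_cases hz : z ∈ {z | h z ≤ b}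
            · rw [indicator_of_mem hz]
              linarith [stdPhi_lt_one ((t - h z) / ε), stdPhi_pos ((t - b) / ε)]
            · rw [indicator_of_notMem hz, zero_add]
              refine strictMono_stdPhi.monotone ?_
              simp only [mem_ofPred_eq, not_le] at hz
              gcongr
        _ = _ := by
            rw [integral_add hi (integrable_const _), integral_indicator (hma b), setIntegral_const]
            simp
    have h3 := stdQuantile_integral_stdPhi_add_le hh hK hε hst
    have hm1 : stdPhi ((s - a) / ε) * (1 / 2) ∈ Ioo (0 : ℝ) 1 :=
      ⟨by have := stdPhi_pos ((s - a) / ε); positivity, by linarith [stdPhi_lt_one ((s - a) / ε)]⟩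
    have hm2 : ∀ r, ∫ z, stdPhi ((r - h z) / ε) ∂γ ∈ Ioo (0 : ℝ) 1 := fun r =>
      integral_stdPhi_mem_Ioo (by fun_prop)
    have h4 := strictMonoOn_stdQuantile.monotoneOn hm1 (hm2 s) h1
    calc _ ≤ stdPhi (stdQuantile (∫ z, stdPhi ((t - h z) / ε) ∂γ)) :=
          strictMono_stdPhi.monotone (by linarith)
      _ = ∫ z, stdPhi ((t - h z) / ε) ∂γ := stdPhi_stdQuantile (hm2 t)
      _ ≤ _ := h2
  have hinv : Tendsto (fun ε : ℝ => ε⁻¹) (𝓝[>] 0) atTop := tendsto_inv_nhdsGT_zero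
  have hl1 : Tendsto (fun ε => stdPhi ((s - a) / ε)) (𝓝[>] 0) (𝓝 1) :=
    tendsto_stdPhi_atTop.comp (hinv.const_mul_atTop (sub_pos.2 has))
  have hl2 : Tendsto (fun ε => stdPhi ((t - b) / ε)) (𝓝[>] 0) (𝓝 0) :=
    tendsto_stdPhi_atBot.comp (hinv.const_mul_atTop_of_neg (sub_neg.2 htb))
  have hl3 : Tendsto (fun ε : ℝ => (t - s) / √(1 + ε ^ 2)) (𝓝[>] 0) (𝓝 (t - s)) := by
    have : ContinuousAt (fun ε : ℝ => (t - s) / √(1 + ε ^ 2)) 0 := by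
      refine ContinuousAt.div (by fun_prop) (by fun_prop) (by simp)
    simpa using this.tendsto.mono_left nhdsWithin_le_nhds
  have hl4 : Tendsto (fun ε => stdQuantile (stdPhi ((s - a) / ε) * (1 / 2))) (𝓝[>] 0) (𝓝 0) := by
    have h1 : stdQuantile (1 * (1 / 2)) = 0 := by rw [one_mul, ← stdPhi_zero, stdQuantile_stdPhi]
    have h2 := (continuousAt_stdQuantile (y := 1 * (1 / 2)) (by norm_num)).tendsto.comp
      (hl1.mul_const (1 / 2))
    rwa [h1] at h2
  have h5 := (continuous_stdPhi.tendsto _).comp (hl4.add hl3)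
  have h6 := hl2.const_add (γ.real {z | h z ≤ b})
  rw [zero_add] at h5
  rw [add_zero] at h6
  refine le_of_tendsto_of_tendsto h5 h6 ?_
  filter_upwards [self_mem_nhdsWithin] with ε hε using key ε hε

lemma exists_infDist_projection {E : Type*} [NormedAddCommGroup E] [InnerProductSpace ℝ E]
    [CompleteSpace E] {A : Set E} (hA : IsClosed A) (hne : A.Nonempty) (hconv : Convex ℝ A) (z : E) :
    ∃ P ∈ A, ‖z - P‖ = Metric.infDist z A ∧ ∀ w ∈ A, inner ℝ (z - P) (w - P) ≤ 0 := by
  obtain ⟨P, hP, h⟩ := exists_norm_eq_iInf_of_complete_convex hne hA.isComplete hconv z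
  refine ⟨P, hP, ?_, (norm_eq_iInf_iff_real_inner_le_zero hconv hP).1 h⟩
  rw [h, Metric.infDist_eq_iInf]
  simp_rw [dist_eq_norm]

lemma hasQuadraticExpansion_sqrt_infDist {E : Type*} [NormedAddCommGroup E]
    [InnerProductSpace ℝ E] [CompleteSpace E] {A : Set E} (hA : IsClosed A) (hne : A.Nonempty)
    (hconv : Convex ℝ A) {η : ℝ} (hη : 0 < η) :
    HasQuadraticExpansion 1 (1 / (2 * η)) (fun z => √(Metric.infDist z A ^ 2 + η ^ 2)) := by
  intro z
  obtain ⟨P, hP, hd, hin⟩ := exists_infDist_projection hA hne hconv z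
  set u := z - P with hu
  set h := √(Metric.infDist z A ^ 2 + η ^ 2) with hh
  have hη1 : η ≤ h := Real.le_sqrt_of_sq_le (by nlinarith [sq_nonneg (Metric.infDist z A)])
  have hh0 : 0 < h := hη.trans_le hη1
  have hsq : h ^ 2 = ‖u‖ ^ 2 + η ^ 2 := by rw [hh, Real.sq_sqrt (by positivity), hd]
  refine ⟨h⁻¹ • u, ?_, fun v => ?_⟩
  · rw [norm_smul, Real.norm_of_nonneg (by positivity), inv_mul_le_iff₀ hh0, mul_one]
    exact abs_le_of_sq_le_sq' (by nlinarith) hh0.le |>.2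
  · obtain ⟨P', hP', hd', -⟩ := exists_infDist_projection hA hne hconv (z + v)
    set h' := √(Metric.infDist (z + v) A ^ 2 + η ^ 2) with hh'
    have hsq' : h' ^ 2 = ‖z + v - P'‖ ^ 2 + η ^ 2 := by rw [hh', Real.sq_sqrt (by positivity), hd']
    have hup : ‖z + v - P'‖ ^ 2 ≤ ‖u + v‖ ^ 2 := by
      have : ‖z + v - P'‖ ≤ ‖u + v‖ := by
        rw [hd', hu, show z - P + v = z + v - P by abel, ← dist_eq_norm]
        exact Metric.infDist_le_dist_of_mem hP
      gcongr
    rw [norm_add_sq_real] at hup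
    have hlow : h ^ 2 + inner ℝ u v ≤ h' * h := by
      have h1 : ‖u‖ ^ 2 + inner ℝ u v ≤ inner ℝ u (z + v - P') := by
        have h2 := hin P' hP'
        have h3 : inner ℝ u (z + v - P') = inner ℝ u u + inner ℝ u v - inner ℝ u (P' - P) := by
          rw [← inner_add_right, ← inner_sub_right]; congr 1; rw [hu]; abel
        rw [h3, real_inner_self_eq_norm_sq]; linarith
      have h2 := real_inner_le_norm u (z + v - P')
      have h3 : ‖u‖ * ‖z + v - P'‖ + η ^ 2 ≤ h' * h := by
        refine abs_le_of_sq_le_sq' ?_ (by positivity) |>.2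
        rw [mul_pow, hsq, hsq']
        nlinarith [sq_nonneg (‖u‖ - ‖z + v - P'‖),
            mul_nonneg (sq_nonneg η) (sq_nonneg (‖u‖ - ‖z + v - P'‖))]
      rw [hsq]; linarith
    rw [real_inner_smul_left, inv_mul_eq_div, abs_le]
    have e : h' - h - inner ℝ u v / h = (h' * h - h ^ 2 - inner ℝ u v) / h := by field_simp
    constructor
    · rw [e]
      have : 0 ≤ (h' * h - h ^ 2 - inner ℝ u v) / h := div_nonneg (by linarith) hh0.le
      have : 0 ≤ 1 / (2 * η) * ‖v‖ ^ 2 := by positivity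
      linarith
    · rw [e]
      calc _ ≤ (‖v‖ ^ 2 / 2) / h := by
            gcongr
            nlinarith [sq_nonneg (h' - h)]
        _ ≤ (‖v‖ ^ 2 / 2) / η := by gcongr
        _ = _ := by field_simp

/-- The Gaussian isoperimetric inequality for closed convex sets of measure at least `1/2`. -/
theorem stdPhi_le_measureReal_infDist {n : ℕ} {A : Set (EuclideanSpace ℝ (Fin n))}
    (hA : IsClosed A) (hconv : Convex ℝ A)
    (hhalf : 1 / 2 ≤ (stdGaussian (EuclideanSpace ℝ (Fin n))).real A) {t : ℝ} (ht : 0 ≤ t) :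
    stdPhi t ≤ (stdGaussian (EuclideanSpace ℝ (Fin n))).real {z | Metric.infDist z A ≤ t} := by
  have hne : A.Nonempty := by
    by_contra h
    rw [not_nonempty_iff_eq_empty.1 h] at hhalf
    norm_num at hhalf
  rcases ht.eq_or_lt with rfl | ht
  · rw [stdPhi_zero]
    refine hhalf.trans (measureReal_mono fun z hz => ?_)
    simp [Metric.infDist_zero_of_mem hz]
  have key : ∀ η ∈ Ioo 0 (t / 3), stdPhi (t - 3 * η) ≤
      (stdGaussian (EuclideanSpace ℝ (Fin n))).real {z | Metric.infDist z A ≤ t} := by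
    intro η ⟨hη, hη3⟩
    have h1 := stdPhi_sub_le_measureReal (a := η) (s := 2 * η) (t := t - η) (b := t)
      (hasQuadraticExpansion_sqrt_infDist hA hne hconv hη) (by positivity) (by linarith)
      (by linarith) (by linarith)
      (hhalf.trans (measureReal_mono fun z hz => by
        simp [Metric.infDist_zero_of_mem hz, Real.sqrt_sq hη.le]))
    rw [show t - 3 * η = t - η - 2 * η by ring]
    refine h1.trans (measureReal_mono fun z hz => ?_)
    refine le_trans (Real.le_sqrt_of_sq_le ?_) (mem_ofPred_eq ▸ hz)
    nlinarith [sq_nonneg η]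
  have hlim : Tendsto (fun η : ℝ => stdPhi (t - 3 * η)) (𝓝[>] 0) (𝓝 (stdPhi t)) := by
    have : Continuous fun η : ℝ => stdPhi (t - 3 * η) := continuous_stdPhi.comp (by fun_prop)
    simpa using (this.tendsto 0).mono_left nhdsWithin_le_nhds
  refine le_of_tendsto hlim ?_
  filter_upwards [Ioo_mem_nhdsGT (show (0 : ℝ) < t / 3 by positivity)] with η hη using key η hη

lemma integral_exp_mul_sq_gaussianReal {c : ℝ} (hc : c < 1 / 2) :
    ∫ x, Real.exp (c * x ^ 2) ∂(gaussianReal 0 1) = (√(1 - 2 * c))⁻¹ := by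
  rw [integral_gaussianReal_eq_integral_smul one_ne_zero]
  have h : ∀ x : ℝ, gaussianPDFReal 0 1 x • Real.exp (c * x ^ 2) =
      (√(2 * Real.pi))⁻¹ * Real.exp (-((1 - 2 * c) / 2) * x ^ 2) := by
    intro x
    rw [gaussianPDFReal_eq_stdDens, stdDens, smul_eq_mul, mul_assoc, ← Real.exp_add]
    congr 2; ring
  simp_rw [h]
  have h1 : 0 < 1 - 2 * c := by linarith
  have hpi := Real.pi_pos
  rw [integral_const_mul, integral_gaussian, ← Real.sqrt_inv, ← Real.sqrt_inv,
    ← Real.sqrt_mul (by positivity)]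
  congr 1
  field_simp

lemma inv_sqrt_one_sub_le {u a : ℝ} (hu : 0 ≤ u) (ha : 0 < a) (hua : u ≤ 1 - a) :
    (√(1 - u))⁻¹ ≤ Real.exp (u / (2 * a)) := by
  have h1 : 0 < 1 - u := by linarith
  have h2 : (1 - u)⁻¹ ≤ Real.exp (u / a) := by
    calc (1 - u)⁻¹ = u / (1 - u) + 1 := by field_simp; ring
      _ ≤ u / a + 1 := by
          gcongr
          linarith
      _ ≤ _ := Real.add_one_le_exp _
  rw [← Real.sqrt_inv]
  refine Real.sqrt_le_iff.2 ⟨(Real.exp_pos _).le, h2.trans (le_of_eq ?_)⟩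
  rw [← Real.exp_nat_mul]
  congr 1
  field_simp
  norm_num

section QuadraticForm

variable {E ι : Type*} [NormedAddCommGroup E] [InnerProductSpace ℝ E]

/-- The operator `z ↦ ∑ j ∈ s, ⟪v j, z⟫ v j`. -/
noncomputable def frameOperator (s : Finset ι) (v : ι → E) : E →ₗ[ℝ] E :=
  ∑ j ∈ s, (innerₗ E (v j)).smulRight (v j)

lemma frameOperator_apply (s : Finset ι) (v : ι → E) (z : E) :
    frameOperator s v z = ∑ j ∈ s, inner ℝ (v j) z • v j := by
  simp [frameOperator]

lemma isSymmetric_frameOperator (s : Finset ι) (v : ι → E) : (frameOperator s v).IsSymmetric := by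
  intro x y
  simp only [frameOperator_apply, sum_inner, inner_sum, real_inner_smul_left, real_inner_smul_right]
  refine Finset.sum_congr rfl fun j _ => ?_
  rw [real_inner_comm x, mul_comm]

lemma inner_frameOperator (s : Finset ι) (v : ι → E) (z : E) :
    inner ℝ (frameOperator s v z) z = ∑ j ∈ s, inner ℝ (v j) z ^ 2 := by
  simp only [frameOperator_apply, sum_inner, real_inner_smul_left]
  exact Finset.sum_congr rfl fun j _ => by ring

/-- Diagonalization of the quadratic form `z ↦ ∑ ⟪v j, z⟫ ^ 2`. -/
lemma exists_orthonormalBasis_sum_inner_sq {n : ℕ} [FiniteDimensional ℝ E]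
    (hn : Module.finrank ℝ E = n) (s : Finset ι) (v : ι → E) :
    ∃ (b : OrthonormalBasis (Fin n) ℝ E) (μ : Fin n → ℝ),
      (∀ z, ∑ j ∈ s, inner ℝ (v j) z ^ 2 = ∑ i, μ i * inner ℝ (b i) z ^ 2) ∧
      (∀ i, μ i = ∑ j ∈ s, inner ℝ (v j) (b i) ^ 2) ∧ ∑ i, μ i = ∑ j ∈ s, ‖v j‖ ^ 2 := by
  have hT := isSymmetric_frameOperator s v
  set b := hT.eigenvectorBasis hn with hb
  set μ := hT.eigenvalues hn with hμ
  have h2 : ∀ i, μ i = ∑ j ∈ s, inner ℝ (v j) (b i) ^ 2 := by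
    intro i
    rw [← inner_frameOperator, hb, hT.apply_eigenvectorBasis, real_inner_smul_left,
      real_inner_self_eq_norm_sq, OrthonormalBasis.norm_eq_one]
    simp [hμ]
  refine ⟨b, μ, fun z => ?_, h2, ?_⟩
  · rw [← inner_frameOperator, ← b.sum_inner_mul_inner]
    refine Finset.sum_congr rfl fun i _ => ?_
    rw [hT, hb, hT.apply_eigenvectorBasis, real_inner_smul_right, real_inner_comm, ← hb]
    simp only [RCLike.ofReal_real_eq_id, id]
    rw [hμ]; ring
  · simp_rw [h2]
    rw [Finset.sum_comm]
    refine Finset.sum_congr rfl fun j _ => ?_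
    simpa using b.sum_sq_norm_inner_left (v j)

variable [FiniteDimensional ℝ E] [MeasurableSpace E] [BorelSpace E]

lemma integral_exp_sum_inner_sq_le (s : Finset ι) (v : ι → E) {L θ a : ℝ}
    (hL : ∀ z, ∑ j ∈ s, inner ℝ (v j) z ^ 2 ≤ L ^ 2 * ‖z‖ ^ 2) (hθ : 0 ≤ θ) (ha : 0 < a)
    (hθa : 2 * θ * L ^ 2 ≤ 1 - a) :
    Integrable (fun z => Real.exp (θ * ∑ j ∈ s, inner ℝ (v j) z ^ 2)) (stdGaussian E) ∧
    ∫ z, Real.exp (θ * ∑ j ∈ s, inner ℝ (v j) z ^ 2) ∂(stdGaussian E) ≤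
      Real.exp (θ * (∑ j ∈ s, ‖v j‖ ^ 2) / a) := by
  obtain ⟨b, μ, h1, h2, h3⟩ := exists_orthonormalBasis_sum_inner_sq (rfl : Module.finrank ℝ E = _) s v
  have hμ0 : ∀ i, 0 ≤ μ i := fun i => by rw [h2]; positivity
  have hμL : ∀ i, μ i ≤ L ^ 2 := fun i => by
    have := hL (b i)
    rwa [← h2, b.norm_eq_one, one_pow, mul_one] at this
  have hθμ : ∀ i, 2 * (θ * μ i) ≤ 1 - a := fun i => by
    have := mul_le_mul_of_nonneg_left (hμL i) hθ
    linarith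
  have e : ∫ z, Real.exp (θ * ∑ j ∈ s, inner ℝ (v j) z ^ 2) ∂(stdGaussian E) =
      ∏ i, (√(1 - 2 * (θ * μ i)))⁻¹ := by
    have hc : ∀ x : Fin (Module.finrank ℝ E) → ℝ,
        Real.exp (θ * ∑ j ∈ s, inner ℝ (v j) (∑ i, x i • b i) ^ 2) =
        ∏ i, Real.exp (θ * μ i * x i ^ 2) := by
      intro x
      rw [h1, ← Real.exp_sum, Finset.mul_sum]
      congr 1
      refine Finset.sum_congr rfl fun i _ => ?_
      rw [b.orthonormal.inner_right_fintype, mul_assoc]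
    rw [stdGaussian_eq_map_pi_orthonormalBasis b, integral_map
      (Continuous.aemeasurable (by fun_prop)) (by fun_prop)]
    simp_rw [hc]
    rw [integral_fintype_prod_eq_prod (fun i x => Real.exp (θ * μ i * x ^ 2))]
    exact Finset.prod_congr rfl fun i _ => integral_exp_mul_sq_gaussianReal (by linarith [hθμ i])
  refine ⟨?_, ?_⟩
  · refine not_imp_comm.1 integral_undef ?_
    rw [e]
    refine (Finset.prod_pos fun i _ => ?_).ne'
    have : 0 < 1 - 2 * (θ * μ i) := by linarith [hθμ i]
    positivity
  · rw [e, ← h3, Finset.mul_sum, Finset.sum_div, Real.exp_sum]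
    refine Finset.prod_le_prod (fun i _ => by positivity) fun i _ => ?_
    refine (inv_sqrt_one_sub_le (by have := hμ0 i; positivity) ha (hθμ i)).trans (le_of_eq ?_)
    congr 1
    field_simp

/-- Gaussian concentration of `z ↦ √(∑ ⟪v j, z⟫ ^ 2)`. -/
theorem measureReal_lt_sqrt_sum_inner_sq_le (s : Finset ι) (v : ι → E) {L t : ℝ} (hL0 : 0 ≤ L)
    (hL : ∀ z, ∑ j ∈ s, inner ℝ (v j) z ^ 2 ≤ L ^ 2 * ‖z‖ ^ 2) (ht : 0 ≤ t) :
    (stdGaussian E).real {z | √(∑ j ∈ s, ‖v j‖ ^ 2) + L * t < √(∑ j ∈ s, inner ℝ (v j) z ^ 2)} ≤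
      Real.exp (-t ^ 2 / 2) := by
  set τ := ∑ j ∈ s, ‖v j‖ ^ 2 with hτ
  have hτ0 : 0 ≤ τ := by positivity
  set Q : E → ℝ := fun z => ∑ j ∈ s, inner ℝ (v j) z ^ 2 with hQ
  by_cases h0 : ∀ z, Q z ≤ 0
  · have : {z | √τ + L * t < √(Q z)} = ∅ := by
      refine eq_empty_of_forall_notMem fun z hz => ?_
      simp only [mem_ofPred_eq, Real.sqrt_eq_zero_of_nonpos (h0 z)] at hz
      have : 0 ≤ √τ + L * t := by positivity
      linarith
    change (stdGaussian E).real {z | √τ + L * t < √(Q z)} ≤ _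
    rw [this, measureReal_empty]
    positivity
  push Not at h0
  obtain ⟨z₀, hz₀⟩ := h0
  have hLpos : 0 < L := by
    refine hL0.lt_of_ne fun h => ?_
    have := hL z₀
    rw [← h] at this
    norm_num at this
    exact absurd (hz₀.trans_le this) (lt_irrefl _)
  have hτpos : 0 < τ := by
    refine hτ0.lt_of_ne fun h => ?_
    have h1 := (Finset.sum_eq_zero_iff_of_nonneg (fun j _ => by positivity)).1 (hτ.symm.trans h.symm)
    have : Q z₀ = 0 := Finset.sum_eq_zero fun j hj => by
      have := h1 j hj
      simp only [ne_eq, OfNat.ofNat_ne_zero, not_false_eq_true, pow_eq_zero_iff, norm_eq_zero] at this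
      simp [this]
    linarith
  set r := √τ + L * t with hr
  have hsτ : 0 < √τ := Real.sqrt_pos.2 hτpos
  have hr0 : 0 < r := by positivity
  set a := √τ / r with ha
  have ha0 : 0 < a := by positivity
  set θ := t / (2 * L * r) with hθ
  have hθ0 : 0 ≤ θ := by positivity
  obtain ⟨hi, hle⟩ := integral_exp_sum_inner_sq_le s v hL hθ0 ha0 (le_of_eq (by
    rw [hθ, ha]; field_simp; rw [hr]; ring))
  calc _ ≤ (stdGaussian E).real {z | r ^ 2 ≤ Q z} := by
        refine measureReal_mono fun z hz => ?_
        exact ((Real.lt_sqrt hr0.le).1 hz).le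
    _ ≤ Real.exp (-θ * r ^ 2) * mgf Q (stdGaussian E) θ := measure_ge_le_exp_mul_mgf _ hθ0 hi
    _ ≤ Real.exp (-θ * r ^ 2) * Real.exp (θ * τ / a) := by
        gcongr
        exact hle
    _ = _ := by
        rw [← Real.exp_add]
        congr 1
        have : τ = √τ ^ 2 := (Real.sq_sqrt hτ0).symm
        rw [this, ha, hθ]
        field_simp
        rw [hr]; ring

end QuadraticForm

section PenalizedLeastSquares

variable {V E : Type*} [AddCommGroup V] [Module ℝ V] [NormedAddCommGroup E] [InnerProductSpace ℝ E]

/-- Minimizers of a convex penalized least squares criterion satisfy a strengthened optimality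
inequality. -/
lemma strong_optimality {A : V →ₗ[ℝ] E} {pen : V → ℝ} (hpen : ConvexOn ℝ univ pen) {y : E} {b₀ : V}
    (hmin : ∀ b, ‖y - A b₀‖ ^ 2 + pen b₀ ≤ ‖y - A b‖ ^ 2 + pen b) (b : V) :
    ‖y - A b₀‖ ^ 2 + pen b₀ + ‖A b₀ - A b‖ ^ 2 ≤ ‖y - A b‖ ^ 2 + pen b := by
  set d := ‖A b₀ - A b‖ ^ 2 with hd
  have key : ∀ t ∈ Ioo (0 : ℝ) 1,
      ‖y - A b₀‖ ^ 2 + pen b₀ + (1 - t) * d ≤ ‖y - A b‖ ^ 2 + pen b := by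
    intro t ⟨ht0, ht1⟩
    have h1 := hpen.2 (mem_univ b₀) (mem_univ b) (sub_nonneg.2 ht1.le) ht0.le (by ring)
    have h2 := hmin ((1 - t) • b₀ + t • b)
    have h3 : y - A ((1 - t) • b₀ + t • b) = (1 - t) • (y - A b₀) + t • (y - A b) := by
      rw [map_add, map_smul, map_smul]; module
    have h4 : d = ‖(y - A b) - (y - A b₀)‖ ^ 2 := by rw [hd, sub_sub_sub_cancel_left]
    rw [norm_sub_sq_real] at h4
    rw [h3, norm_add_sq_real, norm_smul, norm_smul, real_inner_smul_left, real_inner_smul_right,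
      mul_pow, mul_pow, Real.norm_eq_abs, Real.norm_eq_abs, sq_abs, sq_abs,
      real_inner_comm (y - A b)] at h2
    simp only [smul_eq_mul] at h1
    have h5 : 0 ≤ t * (‖y - A b‖ ^ 2 + pen b - (‖y - A b₀‖ ^ 2 + pen b₀ + (1 - t) * d)) := by
      rw [h4]
      nlinarith
    have := nonneg_of_mul_nonneg_right h5 ht0
    linarith
  have hlim : Tendsto (fun t : ℝ => ‖y - A b₀‖ ^ 2 + pen b₀ + (1 - t) * d) (𝓝[>] 0)
      (𝓝 (‖y - A b₀‖ ^ 2 + pen b₀ + d)) := by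
    have : Continuous fun t : ℝ => ‖y - A b₀‖ ^ 2 + pen b₀ + (1 - t) * d := by fun_prop
    simpa using (this.tendsto 0).mono_left nhdsWithin_le_nhds
  refine le_of_tendsto hlim ?_
  filter_upwards [Ioo_mem_nhdsGT (zero_lt_one' ℝ)] with t ht using key t ht

/-- The fitted values of convex penalized least squares are a nonexpansive function of the data. -/
lemma norm_fit_sub_le {A : V →ₗ[ℝ] E} {pen : V → ℝ} (hpen : ConvexOn ℝ univ pen) {bhat : E → V}
    (hmin : ∀ y b, ‖y - A (bhat y)‖ ^ 2 + pen (bhat y) ≤ ‖y - A b‖ ^ 2 + pen b) (y y' : E) :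
    ‖A (bhat y) - A (bhat y')‖ ≤ ‖y - y'‖ := by
  have h1 := strong_optimality hpen (hmin y) (bhat y')
  have h2 := strong_optimality hpen (hmin y') (bhat y)
  rw [norm_sub_rev (A (bhat y'))] at h2
  set u := A (bhat y)
  set u' := A (bhat y')
  have h3 : ‖u - u'‖ ^ 2 ≤ inner ℝ (y - y') (u - u') := by
    have e : inner ℝ (y - y') (u - u') =
        inner ℝ y u - inner ℝ y u' - (inner ℝ y' u - inner ℝ y' u') := by
      simp only [inner_sub_left, inner_sub_right]; ring
    rw [norm_sub_sq_real y, norm_sub_sq_real y] at h1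
    rw [norm_sub_sq_real y', norm_sub_sq_real y'] at h2
    rw [e]
    linarith
  have h4 := h3.trans (real_inner_le_norm _ _)
  rcases (norm_nonneg (u - u')).eq_or_lt with h | h
  · rw [← h]; positivity
  · exact le_of_mul_le_mul_right (by linarith) h

end PenalizedLeastSquares

section GroupNorm

variable {p : ℕ}

lemma groupNorm_eq_norm (G : Finset (Fin p)) (β : Fin p → ℝ) :
    groupNorm G β = ‖(WithLp.toLp 2 fun j : G => β j : EuclideanSpace ℝ G)‖ := by
  rw [groupNorm, EuclideanSpace.norm_eq]
  simp only [Real.norm_eq_abs, sq_abs]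
  rw [Finset.sum_coe_sort G fun j => β j ^ 2]

lemma groupNorm_nonneg (G : Finset (Fin p)) (β : Fin p → ℝ) : 0 ≤ groupNorm G β := Real.sqrt_nonneg _

lemma groupNorm_add_le (G : Finset (Fin p)) (β β' : Fin p → ℝ) :
    groupNorm G (β + β') ≤ groupNorm G β + groupNorm G β' := by
  simp_rw [groupNorm_eq_norm]
  exact norm_add_le (WithLp.toLp 2 fun j : G => β j : EuclideanSpace ℝ G)
    (WithLp.toLp 2 fun j : G => β' j)

lemma groupNorm_smul (G : Finset (Fin p)) (c : ℝ) (β : Fin p → ℝ) :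
    groupNorm G (c • β) = |c| * groupNorm G β := by
  simp_rw [groupNorm_eq_norm]
  exact norm_smul c (WithLp.toLp 2 fun j : G => β j : EuclideanSpace ℝ G)

lemma groupNorm_neg (G : Finset (Fin p)) (β : Fin p → ℝ) : groupNorm G (-β) = groupNorm G β := by
  simp [groupNorm]

lemma convexOn_groupNorm (G : Finset (Fin p)) : ConvexOn ℝ univ (groupNorm G) := by
  refine ⟨convex_univ, fun x _ y _ a b ha hb _ => ?_⟩
  refine (groupNorm_add_le _ _ _).trans (le_of_eq ?_)
  rw [groupNorm_smul, groupNorm_smul, abs_of_nonneg ha, abs_of_nonneg hb]; rfl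

lemma sum_mul_le_groupNorm (G : Finset (Fin p)) (a b : Fin p → ℝ) :
    ∑ j ∈ G, a j * b j ≤ groupNorm G a * groupNorm G b := Real.sum_mul_le_sqrt_mul_sqrt _ _ _

lemma continuous_groupNorm (G : Finset (Fin p)) : Continuous (groupNorm G) := by
  unfold groupNorm; fun_prop

lemma sum_partition {M : ℕ} {G : Fin M → Finset (Fin p)}
    (hdisj : ∀ k l : Fin M, k ≠ l → Disjoint (G k) (G l))
    (hcover : Finset.univ.biUnion G = (Finset.univ : Finset (Fin p))) (h : Fin p → ℝ) :
    ∑ j, h j = ∑ k, ∑ j ∈ G k, h j := by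
  rw [← hcover, Finset.sum_biUnion fun k _ l _ hkl => hdisj k l hkl]

lemma sum_groupNorm_le {M : ℕ} {G : Fin M → Finset (Fin p)}
    (hdisj : ∀ k l : Fin M, k ≠ l → Disjoint (G k) (G l))
    (hcover : Finset.univ.biUnion G = (Finset.univ : Finset (Fin p))) (S : Finset (Fin M))
    (β : Fin p → ℝ) :
    ∑ k ∈ S, groupNorm (G k) β ≤ √S.card * √(∑ j, β j ^ 2) := by
  have h := Real.sum_mul_le_sqrt_mul_sqrt S (fun _ => 1) fun k => groupNorm (G k) β
  simp only [one_mul, one_pow, Finset.sum_const, nsmul_eq_mul, mul_one] at h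
  refine h.trans ?_
  gcongr
  rw [sum_partition hdisj hcover]
  simp_rw [groupNorm]
  calc _ ≤ ∑ k, √(∑ j ∈ G k, β j ^ 2) ^ 2 :=
        Finset.sum_le_sum_of_subset_of_nonneg (Finset.subset_univ _) fun _ _ _ => by positivity
    _ = _ := Finset.sum_congr rfl fun k _ => Real.sq_sqrt (by positivity)

end GroupNorm

section ScaledNorm

variable {n : ℕ}

lemma scaledNorm_eq (u : Fin n → ℝ) : scaledNorm u = ‖WithLp.toLp 2 u‖ / √n := by
  rw [scaledNorm, EuclideanSpace.norm_eq, Real.sqrt_div (by positivity)]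
  simp

lemma scaledNorm_sq (u : Fin n → ℝ) : scaledNorm u ^ 2 = ‖WithLp.toLp 2 u‖ ^ 2 / n := by
  rw [scaledNorm_eq, div_pow, Real.sq_sqrt (by positivity)]

lemma scaledNorm_nonneg (u : Fin n → ℝ) : 0 ≤ scaledNorm u := Real.sqrt_nonneg _

end ScaledNorm

section Design

variable {n p : ℕ} (X : Matrix (Fin n) (Fin p) ℝ)

/-- The columns of a matrix, as vectors of the Euclidean space. -/
noncomputable def designColumn (j : Fin p) : EuclideanSpace ℝ (Fin n) := WithLp.toLp 2 fun i => X i j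

lemma inner_designColumn (j : Fin p) (z : EuclideanSpace ℝ (Fin n)) :
    inner ℝ (designColumn X j) z = X.transpose.mulVec (WithLp.ofLp z) j := by
  simp [designColumn, PiLp.inner_apply, Matrix.mulVec, dotProduct, mul_comm]

lemma sum_mulVec_sq_le (x : Fin p → ℝ) :
    ∑ i, X.mulVec x i ^ 2 ≤ (∑ i, ∑ j, X i j ^ 2) * ∑ j, x j ^ 2 := by
  rw [Finset.sum_mul]
  exact Finset.sum_le_sum fun i _ => Finset.sum_mul_sq_le_sq_mul_sq Finset.univ (X i) x

lemma bddAbove_subSpecNorm (G : Finset (Fin p)) :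
    BddAbove {r | ∃ x : Fin p → ℝ, (∀ j ∉ G, x j = 0) ∧ (∑ j, x j ^ 2) ≤ 1 ∧
      r = Real.sqrt (∑ i, X.mulVec x i ^ 2)} := by
  refine ⟨√(∑ i, ∑ j, X i j ^ 2), ?_⟩
  rintro r ⟨x, -, hx, rfl⟩
  refine Real.sqrt_le_sqrt ((sum_mulVec_sq_le X x).trans ?_)
  exact mul_le_of_le_one_right (by positivity) hx

lemma subSpecNorm_nonneg (G : Finset (Fin p)) : 0 ≤ subSpecNorm X G :=
  Real.sSup_nonneg fun _ ⟨_, _, _, hr⟩ => hr ▸ Real.sqrt_nonneg _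

lemma sqrt_sum_mulVec_sq_le {G : Finset (Fin p)} {x : Fin p → ℝ} (hx : ∀ j ∉ G, x j = 0) :
    √(∑ i, X.mulVec x i ^ 2) ≤ subSpecNorm X G * √(∑ j, x j ^ 2) := by
  set q := √(∑ j, x j ^ 2) with hq
  have hq0 : 0 ≤ q := Real.sqrt_nonneg _
  have hqq : ∑ j, x j ^ 2 = q ^ 2 := (Real.sq_sqrt (by positivity)).symm
  rcases hq0.eq_or_lt with h | h
  · have := sum_mulVec_sq_le X x
    rw [hqq, ← h, zero_pow two_ne_zero, mul_zero] at this
    rw [Real.sqrt_eq_zero_of_nonpos this, ← h, mul_zero]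
  · have h1 : √(∑ i, X.mulVec (q⁻¹ • x) i ^ 2) ≤ subSpecNorm X G := by
      refine le_csSup (bddAbove_subSpecNorm X G) ⟨q⁻¹ • x, fun j hj => by simp [hx j hj], ?_, rfl⟩
      simp only [Pi.smul_apply, smul_eq_mul, mul_pow, ← Finset.mul_sum, hqq]
      exact le_of_eq (by field_simp)
    rw [Matrix.mulVec_smul] at h1
    simp only [Pi.smul_apply, smul_eq_mul, mul_pow, ← Finset.mul_sum] at h1
    rw [Real.sqrt_mul (by positivity), Real.sqrt_sq (by positivity), inv_mul_le_iff₀ h] at h1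
    linarith

lemma sum_inner_designColumn_sq_le (G : Finset (Fin p)) (z : EuclideanSpace ℝ (Fin n)) :
    ∑ j ∈ G, inner ℝ (designColumn X j) z ^ 2 ≤ subSpecNorm X G ^ 2 * ‖z‖ ^ 2 := by
  classical
  set Q := ∑ j ∈ G, inner ℝ (designColumn X j) z ^ 2 with hQ
  have hQ0 : 0 ≤ Q := by positivity
  let c : Fin p → ℝ := fun j => if j ∈ G then inner ℝ (designColumn X j) z else 0
  have hc : ∑ j, c j ^ 2 = Q := by
    simp [c, hQ, ite_pow, Finset.sum_ite_mem]
  have h1 : Q = inner ℝ (WithLp.toLp 2 (X.mulVec c)) z := by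
    have : WithLp.toLp 2 (X.mulVec c) = ∑ j, c j • designColumn X j := by
      ext i
      simp [designColumn, Matrix.mulVec, dotProduct, mul_comm]
    rw [this, sum_inner]
    simp only [real_inner_smul_left, c, ite_mul, zero_mul, Finset.sum_ite_mem, Finset.univ_inter]
    exact Finset.sum_congr rfl fun j _ => sq _
  have h2 : ‖(WithLp.toLp 2 (X.mulVec c) : EuclideanSpace ℝ (Fin n))‖ ≤ subSpecNorm X G * √Q := by
    rw [EuclideanSpace.norm_eq, ← hc]
    simpa using sqrt_sum_mulVec_sq_le X (G := G) (x := c) fun j hj => by simp [c, hj]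
  have h3 : Q ≤ subSpecNorm X G * √Q * ‖z‖ := by
    calc Q ≤ _ := h1.le.trans (real_inner_le_norm _ _)
      _ ≤ _ := by gcongr
  have h4 : √Q ≤ subSpecNorm X G * ‖z‖ := by
    rcases (Real.sqrt_nonneg Q).eq_or_lt with h | h
    · rw [← h]; have := subSpecNorm_nonneg X G; positivity
    · refine le_of_mul_le_mul_right ?_ h
      rw [Real.mul_self_sqrt hQ0]; linarith
  rw [← mul_pow, ← Real.sq_sqrt hQ0]
  gcongr

end Design

section Noise

variable {n p M T : ℕ} (X : Matrix (Fin n) (Fin p) ℝ) (G : Fin M → Finset (Fin p))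

/-- The event that the noise `σ z` has small correlation with every group of columns. -/
def noiseEvent (σ c : ℝ) : Set (EuclideanSpace ℝ (Fin n)) :=
  {z | ∀ k, groupNorm (G k) (X.transpose.mulVec (σ • WithLp.ofLp z)) ≤ c}

lemma isClosed_noiseEvent (σ c : ℝ) : IsClosed (noiseEvent X G σ c) := by
  simp only [noiseEvent, ofPred_forall]
  refine isClosed_iInter fun k => isClosed_le ?_ continuous_const
  refine (continuous_groupNorm _).comp ?_
  fun_prop

lemma convex_noiseEvent (σ c : ℝ) : Convex ℝ (noiseEvent X G σ c) := by
  intro x hx y hy a b ha hb hab k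
  have e : X.transpose.mulVec (σ • WithLp.ofLp (a • x + b • y)) =
      a • X.transpose.mulVec (σ • WithLp.ofLp x) + b • X.transpose.mulVec (σ • WithLp.ofLp y) := by
    rw [← Matrix.mulVec_smul, ← Matrix.mulVec_smul, ← Matrix.mulVec_add]
    congr 1
    simp only [WithLp.ofLp_add, WithLp.ofLp_smul]
    module
  rw [e]
  refine (groupNorm_add_le _ _ _).trans ?_
  rw [groupNorm_smul, groupNorm_smul, abs_of_nonneg ha, abs_of_nonneg hb]
  calc _ ≤ a * c + b * c := by
        have := hx k
        have := hy k
        gcongr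
    _ = c := by rw [← add_mul, hab, one_mul]

lemma groupNorm_transpose_mulVec {σ : ℝ} (hσ : 0 < σ) (S : Finset (Fin p))
    (z : EuclideanSpace ℝ (Fin n)) :
    groupNorm S (X.transpose.mulVec (σ • WithLp.ofLp z)) =
      σ * √(∑ j ∈ S, inner ℝ (designColumn X j) z ^ 2) := by
  rw [Matrix.mulVec_smul, groupNorm_smul, abs_of_pos hσ, groupNorm]
  simp_rw [inner_designColumn]

variable {X G}

lemma half_le_measureReal_noiseEvent (hn : 0 < n) (hcard : ∀ k : Fin M, (G k).card = T)
    {σ : ℝ} (hσ : 0 < σ) (hdiag : ∀ j : Fin p, (1 / n) * ∑ i, X i j ^ 2 ≤ 1)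
    {ψstar : ℝ} (hψ : ψstar = (⨆ k : Fin M, subSpecNorm X (G k)) / Real.sqrt n) {lam : ℝ}
    (hlam : 2 * σ / Real.sqrt n *
      (Real.sqrt T + ψstar * Real.sqrt (2 * Real.log (2 * M))) ≤ lam) :
    1 / 2 ≤ (stdGaussian (EuclideanSpace ℝ (Fin n))).real (noiseEvent X G σ (n * lam / 2)) := by
  set t := √(2 * Real.log (2 * M)) with ht
  set bad : Fin M → Set (EuclideanSpace ℝ (Fin n)) := fun k =>
    {z | √(∑ j ∈ G k, ‖designColumn X j‖ ^ 2) + subSpecNorm X (G k) * t <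
      √(∑ j ∈ G k, inner ℝ (designColumn X j) z ^ 2)} with hbad
  have hn0 : (0 : ℝ) < n := by exact_mod_cast hn
  have hsn : 0 < √(n : ℝ) := Real.sqrt_pos.2 hn0
  have hsub : (noiseEvent X G σ (n * lam / 2))ᶜ ⊆ ⋃ k, bad k := by
    intro z hz
    simp only [noiseEvent, mem_compl_iff, mem_ofPred_eq, not_forall, not_le] at hz
    obtain ⟨k, hk⟩ := hz
    refine mem_iUnion.2 ⟨k, ?_⟩
    rw [groupNorm_transpose_mulVec X hσ] at hk
    have h1 : √(∑ j ∈ G k, ‖designColumn X j‖ ^ 2) ≤ √n * √T := by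
      rw [← Real.sqrt_mul hn0.le]
      refine Real.sqrt_le_sqrt ?_
      have : ∀ j ∈ G k, ‖designColumn X j‖ ^ 2 ≤ n := fun j _ => by
        have h := hdiag j
        rw [one_div, inv_mul_le_iff₀ hn0, mul_one] at h
        simpa [designColumn, EuclideanSpace.real_norm_sq_eq] using h
      refine (Finset.sum_le_sum this).trans (le_of_eq ?_)
      simp [hcard, mul_comm]
    have h2 : subSpecNorm X (G k) ≤ √n * ψstar := by
      rw [hψ, mul_div_cancel₀ _ hsn.ne']
      exact le_ciSup (f := fun k => subSpecNorm X (G k)) (finite_range _).bddAbove k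
    have ht0 : 0 ≤ t := Real.sqrt_nonneg _
    have h3 : σ * (√(∑ j ∈ G k, ‖designColumn X j‖ ^ 2) + subSpecNorm X (G k) * t) ≤
        n * lam / 2 := by
      calc _ ≤ σ * (√n * √T + √n * ψstar * t) := by gcongr
        _ = n * (2 * σ / √n * (√T + ψstar * t)) / 2 := by
            have : (n : ℝ) = √n * √n := (Real.mul_self_sqrt hn0.le).symm
            conv_rhs => rw [this]
            field_simp
            rw [Real.sqrt_sq hsn.le]
            ring
        _ ≤ _ := by gcongr
    exact lt_of_mul_lt_mul_left (h3.trans_lt hk) hσ.le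
  have hk : ∀ k : Fin M, (stdGaussian (EuclideanSpace ℝ (Fin n))).real (bad k) ≤ 1 / (2 * M) := by
    intro k
    have hM : (1 : ℝ) ≤ M := by exact_mod_cast k.pos
    refine (measureReal_lt_sqrt_sum_inner_sq_le (G k) (designColumn X) (subSpecNorm_nonneg X (G k))
      (sum_inner_designColumn_sq_le X (G k)) (Real.sqrt_nonneg _)).trans (le_of_eq ?_)
    have hlog : 0 ≤ Real.log (2 * M) := Real.log_nonneg (by linarith)
    rw [Real.sq_sqrt (by positivity), neg_div, mul_div_cancel_left₀ _ two_ne_zero, Real.exp_neg,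
      Real.exp_log (by positivity), one_div]
  have hsum : (stdGaussian (EuclideanSpace ℝ (Fin n))).real (noiseEvent X G σ (n * lam / 2))ᶜ ≤
      1 / 2 := by
    calc _ ≤ (stdGaussian (EuclideanSpace ℝ (Fin n))).real (⋃ k, bad k) := measureReal_mono hsub
      _ ≤ ∑ k, (stdGaussian (EuclideanSpace ℝ (Fin n))).real (bad k) := measureReal_iUnion_fintype_le _
      _ ≤ ∑ _k : Fin M, (1 / (2 * M) : ℝ) := Finset.sum_le_sum fun k _ => hk k
      _ ≤ 1 / 2 := by
          rw [Finset.sum_const, Finset.card_univ, Fintype.card_fin, nsmul_eq_mul]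
          rcases eq_or_ne (M : ℝ) 0 with h | h
          · rw [h]; norm_num
          · exact le_of_eq (by field_simp)
  rw [probReal_compl_eq_one_sub (isClosed_noiseEvent X G _ _).measurableSet] at hsum
  linarith

end Noise

lemma gaussianVec_eq_map (n : ℕ) (σ : ℝ) :
    gaussianVec n σ =
      (stdGaussian (EuclideanSpace ℝ (Fin n))).map fun z => σ • WithLp.ofLp z := by
  rw [← map_pi_eq_stdGaussian, Measure.map_map (by fun_prop) (by fun_prop)]
  have h := Measure.pi_map_pi (μ := fun _ : Fin n => gaussianReal 0 1)
    (f := fun _ x => σ * x) (fun _ => by fun_prop)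
  simp only [gaussianReal_map_const_mul] at h
  have e : ((fun z : EuclideanSpace ℝ (Fin n) => σ • WithLp.ofLp z) ∘ WithLp.toLp 2) =
      fun (x : Fin n → ℝ) i => σ * x i := rfl
  rw [e, gaussianVec, h]
  simp only [mul_zero, mul_one]
  rfl

section LipschitzTail

variable {n : ℕ} {A : Set (EuclideanSpace ℝ (Fin n))} {F : EuclideanSpace ℝ (Fin n) → ℝ} {r c : ℝ}

lemma stdPhi_le_measureReal_of_lipschitz (hA : IsClosed A) (hconv : Convex ℝ A)
    (hhalf : 1 / 2 ≤ (stdGaussian (EuclideanSpace ℝ (Fin n))).real A) (hc : 0 ≤ c)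
    (hF : ∀ z z', F z - F z' ≤ c * ‖z - z'‖) (hr : ∀ z ∈ A, F z ≤ r) {t : ℝ} (ht : 0 ≤ t) :
    stdPhi t ≤ (stdGaussian (EuclideanSpace ℝ (Fin n))).real {z | F z ≤ r + c * t} := by
  have hne : A.Nonempty := by
    by_contra h
    rw [not_nonempty_iff_eq_empty.1 h] at hhalf
    norm_num at hhalf
  refine (stdPhi_le_measureReal_infDist hA hconv hhalf ht).trans (measureReal_mono fun z hz => ?_)
  obtain ⟨P, hP, h⟩ := hA.exists_infDist_eq_dist hne z
  simp only [mem_ofPred_eq] at hz ⊢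
  rw [h, dist_eq_norm] at hz
  have := hF z P
  have := hr P hP
  nlinarith

lemma lintegral_ofReal_le_of_lipschitz (hA : IsClosed A) (hconv : Convex ℝ A)
    (hhalf : 1 / 2 ≤ (stdGaussian (EuclideanSpace ℝ (Fin n))).real A) (hc : 0 < c)
    (hFc : Continuous F)
    (hF : ∀ z z', F z - F z' ≤ c * ‖z - z'‖) (hr : ∀ z ∈ A, F z ≤ r) :
    ∫⁻ z, ENNReal.ofReal (F z) ∂(stdGaussian (EuclideanSpace ℝ (Fin n))) ≤
      ENNReal.ofReal r + ENNReal.ofReal (c * (√(2 * Real.pi))⁻¹) := by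
  set γ := stdGaussian (EuclideanSpace ℝ (Fin n)) with hγ
  have htail : ∫⁻ z, ENNReal.ofReal (max (F z - r) 0) ∂γ ≤
      ∫⁻ x, ENNReal.ofReal (max (c * x) 0) ∂(gaussianReal 0 1) := by
    rw [lintegral_eq_lintegral_meas_lt γ (f := fun z => max (F z - r) 0)
        (ae_of_all _ fun z => le_max_right _ _)
        (Continuous.aemeasurable (by fun_prop)),
      lintegral_eq_lintegral_meas_lt _ (f := fun x => max (c * x) 0)
        (ae_of_all _ fun z => le_max_right _ _)
        (Continuous.aemeasurable (by fun_prop))]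
    refine setLIntegral_mono' measurableSet_Ioi fun t ht => ?_
    have ht0 : 0 < t := ht
    have e1 : {z | t < max (F z - r) 0} = {z | F z ≤ r + c * (t / c)}ᶜ := by
      ext z
      rw [mul_div_cancel₀ _ hc.ne']
      simp only [mem_ofPred_eq, lt_max_iff, mem_compl_iff, not_le, not_lt_of_gt ht0, or_false]
      exact lt_sub_iff_add_lt'
    have e2 : {x : ℝ | t < max (c * x) 0} = (Iic (t / c))ᶜ := by
      ext x
      simp only [mem_ofPred_eq, lt_max_iff, mem_compl_iff, mem_Iic, not_le, not_lt_of_gt ht0, or_false]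
      rw [div_lt_iff₀ hc, mul_comm]
    have hm : MeasurableSet {z | F z ≤ r + c * (t / c)} :=
      measurableSet_le hFc.measurable measurable_const
    rw [e1, e2, ← ENNReal.toReal_le_toReal (measure_ne_top _ _) (measure_ne_top _ _)]
    have h1 := stdPhi_le_measureReal_of_lipschitz hA hconv hhalf hc.le hF hr
      (t := t / c) (by positivity)
    change γ.real _ ≤ (gaussianReal 0 1).real _
    rw [probReal_compl_eq_one_sub hm, probReal_compl_eq_one_sub measurableSet_Iic]
    exact sub_le_sub_left h1 _
  have he : ∫⁻ x, ENNReal.ofReal (max (c * x) 0) ∂(gaussianReal 0 1) =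
      ENNReal.ofReal (c * (√(2 * Real.pi))⁻¹) := by
    have : ∀ x : ℝ, ENNReal.ofReal (max (c * x) 0) = ENNReal.ofReal c * ENNReal.ofReal x := fun x => by
      rw [← ENNReal.ofReal_mul hc.le, ENNReal.ofReal_max]; simp
    simp_rw [this]
    rw [lintegral_const_mul _ (by fun_prop), lintegral_ofReal_gaussianReal, ENNReal.ofReal_mul hc.le]
  calc _ ≤ ∫⁻ z, (ENNReal.ofReal r + ENNReal.ofReal (max (F z - r) 0)) ∂γ := by
        refine lintegral_mono fun z => ?_
        refine le_trans (ENNReal.ofReal_le_ofReal ?_) ENNReal.ofReal_add_le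
        linarith [le_max_left (F z - r) 0]
    _ ≤ _ := by
        rw [lintegral_add_left measurable_const]
        simp only [lintegral_const, measure_univ, mul_one]
        gcongr
        exact htail.trans he.le

end LipschitzTail

section GroupLasso

variable {n p M : ℕ} {G : Fin M → Finset (Fin p)} {f : Fin n → ℝ} {X : Matrix (Fin n) (Fin p) ℝ}
  {lam : ℝ} {βhat : (Fin n → ℝ) → (Fin p → ℝ)}

/-- The fitted values of a linear model, as a linear map into the Euclidean space. -/
noncomputable def fitMap (X : Matrix (Fin n) (Fin p) ℝ) : (Fin p → ℝ) →ₗ[ℝ] EuclideanSpace ℝ (Fin n) :=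
  (WithLp.linearEquiv 2 ℝ (Fin n → ℝ)).symm.toLinearMap ∘ₗ X.mulVecLin

lemma fitMap_apply (b : Fin p → ℝ) : fitMap X b = WithLp.toLp 2 (X.mulVec b) := rfl

/-- The group LASSO penalty, in the scaling of the squared Euclidean norm. -/
noncomputable def groupPenalty (n : ℕ) (G : Fin M → Finset (Fin p)) (lam : ℝ) (b : Fin p → ℝ) : ℝ :=
  n * (2 * lam) * ∑ k, groupNorm (G k) b

lemma convexOn_groupPenalty (hlam0 : 0 ≤ lam) : ConvexOn ℝ univ (groupPenalty n G lam) := by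
  have h : ConvexOn ℝ univ fun b => ∑ k, groupNorm (G k) b := by
    refine ⟨convex_univ, fun x _ y _ a b ha hb hab => ?_⟩
    simp only [Finset.smul_sum, ← Finset.sum_add_distrib]
    exact Finset.sum_le_sum fun k _ => (convexOn_groupNorm (G k)).2 trivial trivial ha hb hab
  exact h.smul (c := n * (2 * lam)) (by positivity)

lemma norm_sub_fitMap_add_groupPenalty_le (hn : 0 < n)
    (hmin : ∀ (y : Fin n → ℝ) (b : Fin p → ℝ),
      scaledNorm (y - X.mulVec (βhat y)) ^ 2 + 2 * lam * ∑ k, groupNorm (G k) (βhat y)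
        ≤ scaledNorm (y - X.mulVec b) ^ 2 + 2 * lam * ∑ k, groupNorm (G k) b)
    (y : EuclideanSpace ℝ (Fin n)) (b : Fin p → ℝ) :
    ‖y - fitMap X (βhat (WithLp.ofLp y))‖ ^ 2 + groupPenalty n G lam (βhat (WithLp.ofLp y)) ≤
      ‖y - fitMap X b‖ ^ 2 + groupPenalty n G lam b := by
  have hn0 : (0 : ℝ) < n := by exact_mod_cast hn
  have h := mul_le_mul_of_nonneg_left (hmin (WithLp.ofLp y) b) hn0.le
  rw [mul_add, mul_add, scaledNorm_sq, scaledNorm_sq, mul_div_cancel₀ _ hn0.ne',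
    mul_div_cancel₀ _ hn0.ne', WithLp.toLp_sub, WithLp.toLp_sub, WithLp.toLp_ofLp,
    ← fitMap_apply, ← fitMap_apply] at h
  simpa only [groupPenalty, mul_assoc] using h

/-- The prediction error is a Lipschitz function of the noise. -/
lemma scaledNorm_fit_sub_le (hn : 0 < n) (hlam0 : 0 ≤ lam)
    (hmin : ∀ (y : Fin n → ℝ) (b : Fin p → ℝ),
      scaledNorm (y - X.mulVec (βhat y)) ^ 2 + 2 * lam * ∑ k, groupNorm (G k) (βhat y)
        ≤ scaledNorm (y - X.mulVec b) ^ 2 + 2 * lam * ∑ k, groupNorm (G k) b)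
    (z z' : EuclideanSpace ℝ (Fin n)) :
    scaledNorm (X.mulVec (βhat (f + WithLp.ofLp z)) - f) -
      scaledNorm (X.mulVec (βhat (f + WithLp.ofLp z')) - f) ≤ ‖z - z'‖ / √n := by
  have h := norm_fit_sub_le (convexOn_groupPenalty hlam0)
    (norm_sub_fitMap_add_groupPenalty_le hn hmin) (WithLp.toLp 2 f + z) (WithLp.toLp 2 f + z')
  rw [add_sub_add_left_eq_sub] at h
  rw [scaledNorm_eq, scaledNorm_eq, ← sub_div]
  gcongr
  refine (norm_sub_norm_le _ _).trans ?_
  rw [WithLp.toLp_sub, WithLp.toLp_sub, sub_sub_sub_cancel_right]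
  exact h

lemma inner_fitMap_le (hdisj : ∀ k l : Fin M, k ≠ l → Disjoint (G k) (G l))
    (hcover : Finset.univ.biUnion G = (Finset.univ : Finset (Fin p))) {ξ : Fin n → ℝ} {c : ℝ}
    (hξ : ∀ k, groupNorm (G k) (X.transpose.mulVec ξ) ≤ c) (b : Fin p → ℝ) :
    inner ℝ (WithLp.toLp 2 ξ) (fitMap X b) ≤ c * ∑ k, groupNorm (G k) b := by
  have e : inner ℝ (WithLp.toLp 2 ξ) (fitMap X b) = ∑ j, X.transpose.mulVec ξ j * b j := by
    have h1 : inner ℝ (WithLp.toLp 2 ξ) (fitMap X b) = X.mulVec b ⬝ᵥ ξ := by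
      rw [fitMap_apply, EuclideanSpace.inner_toLp_toLp]; simp
    rw [h1, dotProduct_comm, Matrix.dotProduct_mulVec, Matrix.mulVec_transpose]; rfl
  rw [e, sum_partition hdisj hcover, Finset.mul_sum]
  refine Finset.sum_le_sum fun k _ => (sum_mul_le_groupNorm _ _ _).trans ?_
  exact mul_le_mul_of_nonneg_right (hξ k) (groupNorm_nonneg _ _)

/-- Basic inequality of the group LASSO. -/
lemma sq_scaledNorm_add_le (hn : 0 < n) (hdisj : ∀ k l : Fin M, k ≠ l → Disjoint (G k) (G l))
    (hcover : Finset.univ.biUnion G = (Finset.univ : Finset (Fin p))) (hlam0 : 0 ≤ lam)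
    (hmin : ∀ (y : Fin n → ℝ) (b : Fin p → ℝ),
      scaledNorm (y - X.mulVec (βhat y)) ^ 2 + 2 * lam * ∑ k, groupNorm (G k) (βhat y)
        ≤ scaledNorm (y - X.mulVec b) ^ 2 + 2 * lam * ∑ k, groupNorm (G k) b)
    {ξ : Fin n → ℝ} (hξ : ∀ k, groupNorm (G k) (X.transpose.mulVec ξ) ≤ n * lam / 2)
    {S : Finset (Fin M)} {β : Fin p → ℝ} (hβ : ∀ k ∉ S, ∀ j ∈ G k, β j = 0) :
    scaledNorm (X.mulVec (βhat (f + ξ)) - f) ^ 2 +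
        scaledNorm (X.mulVec (βhat (f + ξ) - β)) ^ 2 ≤
      scaledNorm (X.mulVec β - f) ^ 2 +
        lam * (3 * ∑ k ∈ S, groupNorm (G k) (βhat (f + ξ) - β) -
          ∑ k ∈ Sᶜ, groupNorm (G k) (βhat (f + ξ) - β)) := by
  have hn0 : (0 : ℝ) < n := by exact_mod_cast hn
  set y : EuclideanSpace ℝ (Fin n) := WithLp.toLp 2 (f + ξ) with hy
  set b := βhat (f + ξ) with hb
  have h1 := strong_optimality (convexOn_groupPenalty hlam0)
    (norm_sub_fitMap_add_groupPenalty_le hn hmin y) β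
  change ‖y - fitMap X b‖ ^ 2 + groupPenalty n G lam b + _ ≤ _ at h1
  have h2 := inner_fitMap_le (X := X) hdisj hcover hξ (b - β)
  have hres : ∀ v, ‖y - fitMap X v‖ ^ 2 = ‖WithLp.toLp 2 ξ‖ ^ 2 -
      2 * inner ℝ (WithLp.toLp 2 ξ) (WithLp.toLp 2 (X.mulVec v - f)) +
      ‖WithLp.toLp 2 (X.mulVec v - f)‖ ^ 2 := fun v => by
    rw [← norm_sub_sq_real]
    congr 2
    rw [hy, fitMap_apply, WithLp.toLp_add, WithLp.toLp_sub]
    abel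
  have hinner : inner ℝ (WithLp.toLp 2 ξ) (fitMap X (b - β)) =
      inner ℝ (WithLp.toLp 2 ξ) (WithLp.toLp 2 (X.mulVec b - f)) -
      inner ℝ (WithLp.toLp 2 ξ) (WithLp.toLp 2 (X.mulVec β - f)) := by
    rw [← inner_sub_right, map_sub, fitMap_apply, fitMap_apply, WithLp.toLp_sub, WithLp.toLp_sub,
      sub_sub_sub_cancel_right]
  have hpen : ∑ k, groupNorm (G k) (b - β) + 2 * ∑ k, groupNorm (G k) β -
      2 * ∑ k, groupNorm (G k) b ≤
      3 * ∑ k ∈ S, groupNorm (G k) (b - β) - ∑ k ∈ Sᶜ, groupNorm (G k) (b - β) := by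
    have hS : ∑ k ∈ S, groupNorm (G k) β ≤
        ∑ k ∈ S, groupNorm (G k) b + ∑ k ∈ S, groupNorm (G k) (b - β) := by
      rw [← Finset.sum_add_distrib]
      refine Finset.sum_le_sum fun k _ => ?_
      have := groupNorm_add_le (G k) b (-(b - β))
      rwa [groupNorm_neg, ← sub_eq_add_neg, sub_sub_cancel] at this
    have hSc0 : ∑ k ∈ Sᶜ, groupNorm (G k) β = 0 := Finset.sum_eq_zero fun k hk => by
      rw [groupNorm, Finset.sum_eq_zero, Real.sqrt_zero]
      intro j hj
      rw [hβ k (Finset.mem_compl.1 hk) j hj]; norm_num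
    have hSc : ∑ k ∈ Sᶜ, groupNorm (G k) (b - β) = ∑ k ∈ Sᶜ, groupNorm (G k) b :=
      Finset.sum_congr rfl fun k hk => by
        rw [groupNorm, groupNorm]
        congr 1
        refine Finset.sum_congr rfl fun j hj => ?_
        rw [Pi.sub_apply, hβ k (Finset.mem_compl.1 hk) j hj, sub_zero]
    rw [← Finset.sum_add_sum_compl S fun k => groupNorm (G k) (b - β),
      ← Finset.sum_add_sum_compl S fun k => groupNorm (G k) b,
      ← Finset.sum_add_sum_compl S fun k => groupNorm (G k) β, hSc0, hSc]
    linarith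
  have hpen' := mul_le_mul_of_nonneg_left hpen (mul_nonneg hn0.le hlam0)
  rw [← map_sub, fitMap_apply (b - β), hres, hres, groupPenalty, groupPenalty] at h1
  rw [hinner] at h2
  rw [scaledNorm_sq, scaledNorm_sq, scaledNorm_sq, ← add_div, div_add' _ _ _ hn0.ne']
  exact div_le_div_of_nonneg_right (by linarith) hn0.le

lemma kappaGSq_nonneg (S : Finset (Fin M)) (c₀ : ℝ) : 0 ≤ kappaGSq X G S c₀ := by
  refine Real.sInf_nonneg ?_
  rintro r ⟨Δ, -, -, rfl⟩
  positivity

lemma kappaGSq_mul_le {S : Finset (Fin M)} {c₀ : ℝ} {Δ : Fin p → ℝ}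
    (hΔ : ∑ k ∈ Sᶜ, groupNorm (G k) Δ ≤ c₀ * ∑ k ∈ S, groupNorm (G k) Δ) :
    kappaGSq X G S c₀ * ∑ j, Δ j ^ 2 ≤ scaledNorm (X.mulVec Δ) ^ 2 := by
  rcases eq_or_ne Δ 0 with rfl | h0
  · simp [sq_nonneg]
  have hpos : 0 < ∑ j, Δ j ^ 2 := by
    obtain ⟨j, hj⟩ := Function.ne_iff.1 h0
    exact Finset.sum_pos' (fun _ _ => sq_nonneg _)
      ⟨j, Finset.mem_univ _, by simpa using pow_pos (abs_pos.2 hj) 2⟩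
  rw [← le_div_iff₀ hpos]
  refine csInf_le ⟨0, ?_⟩ ⟨Δ, h0, hΔ, rfl⟩
  rintro r ⟨Δ', -, -, rfl⟩
  positivity

/-- Deterministic oracle inequality of the group LASSO under small noise correlation. -/
lemma ofReal_scaledNorm_le (hn : 0 < n) (hdisj : ∀ k l : Fin M, k ≠ l → Disjoint (G k) (G l))
    (hcover : Finset.univ.biUnion G = (Finset.univ : Finset (Fin p))) (hlam0 : 0 ≤ lam)
    (hmin : ∀ (y : Fin n → ℝ) (b : Fin p → ℝ),
      scaledNorm (y - X.mulVec (βhat y)) ^ 2 + 2 * lam * ∑ k, groupNorm (G k) (βhat y)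
        ≤ scaledNorm (y - X.mulVec b) ^ 2 + 2 * lam * ∑ k, groupNorm (G k) b)
    {ξ : Fin n → ℝ} (hξ : ∀ k, groupNorm (G k) (X.transpose.mulVec ξ) ≤ n * lam / 2)
    {S : Finset (Fin M)} {β : Fin p → ℝ} (hβ : ∀ k ∉ S, ∀ j ∈ G k, β j = 0) :
    ENNReal.ofReal (scaledNorm (X.mulVec (βhat (f + ξ)) - f)) ≤
      ENNReal.ofReal (scaledNorm (X.mulVec β - f)) +
        ENNReal.ofReal (3 * lam * √S.card) / ENNReal.ofReal (2 * √(kappaGSq X G S 3)) := by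
  have hbasic := sq_scaledNorm_add_le (f := f) hn hdisj hcover hlam0 hmin hξ hβ
  set Δ := βhat (f + ξ) - β
  set F := scaledNorm (X.mulVec (βhat (f + ξ)) - f)
  set B := scaledNorm (X.mulVec β - f) with hB
  set D := scaledNorm (X.mulVec Δ) with hD
  clear_value Δ
  have hB0 : 0 ≤ B := scaledNorm_nonneg _
  have hD0 : 0 ≤ D := scaledNorm_nonneg _
  have hSc : 0 ≤ ∑ k ∈ Sᶜ, groupNorm (G k) Δ := Finset.sum_nonneg fun k _ => groupNorm_nonneg _ _
  have of_le : F ^ 2 ≤ B ^ 2 → ENNReal.ofReal F ≤ ENNReal.ofReal B +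
      ENNReal.ofReal (3 * lam * √S.card) / ENNReal.ofReal (2 * √(kappaGSq X G S 3)) := fun h =>
    (ENNReal.ofReal_le_ofReal (le_of_sq_le_sq h hB0)).trans le_self_add
  rcases le_or_gt (3 * ∑ k ∈ S, groupNorm (G k) Δ) (∑ k ∈ Sᶜ, groupNorm (G k) Δ) with hcone | hcone
  · refine of_le ?_
    have := mul_nonpos_of_nonneg_of_nonpos hlam0 (sub_nonpos.2 hcone)
    nlinarith
  have hκ := kappaGSq_mul_le (X := X) hcone.le
  have hsum := sum_groupNorm_le hdisj hcover S Δ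
  rw [← hD] at hκ
  have hs0 : 0 ≤ √(S.card : ℝ) := Real.sqrt_nonneg _
  generalize √(S.card : ℝ) = s at *
  set N := √(∑ j, Δ j ^ 2) with hN
  have hN0 : 0 ≤ N := Real.sqrt_nonneg _
  have hNN : ∑ j, Δ j ^ 2 = N ^ 2 := (Real.sq_sqrt (by positivity)).symm
  have hmain : F ^ 2 + D ^ 2 ≤ B ^ 2 + 3 * lam * s * N := by
    have : lam * (3 * ∑ k ∈ S, groupNorm (G k) Δ - ∑ k ∈ Sᶜ, groupNorm (G k) Δ) ≤
        lam * (3 * (s * N)) := by gcongr; linarith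
    linarith
  have hnum : 0 ≤ 3 * lam * s := by positivity
  rcases hnum.eq_or_lt with h0 | hpos
  · refine of_le ?_
    rw [← h0] at hmain
    nlinarith
  set κ := √(kappaGSq X G S 3) with hκdef
  have hκκ : kappaGSq X G S 3 = κ ^ 2 := (Real.sq_sqrt (kappaGSq_nonneg S 3)).symm
  rcases (Real.sqrt_nonneg (kappaGSq X G S 3)).eq_or_lt with hκ0 | hκ0
  · rw [← hκdef] at hκ0
    rw [← hκ0, mul_zero, ENNReal.ofReal_zero, ENNReal.div_zero (by simpa using hpos)]
    simp
  rw [← hκdef] at hκ0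
  rw [hκκ, hNN, ← mul_pow] at hκ
  have hκN : κ * N ≤ D := le_of_sq_le_sq hκ hD0
  set ρ := 3 * lam * s / (2 * κ) with hρ
  have hρ0 : 0 ≤ ρ := by positivity
  have hρe : 3 * lam * s * N = 2 * ρ * (κ * N) := by rw [hρ]; field_simp
  rw [← ENNReal.ofReal_div_of_pos (by positivity), ← ENNReal.ofReal_add hB0 hρ0]
  refine ENNReal.ofReal_le_ofReal (le_of_sq_le_sq ?_ (by positivity))
  have : ρ * (κ * N) ≤ ρ * D := by gcongr
  nlinarith [sq_nonneg (ρ - D), mul_nonneg hB0 hρ0]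

end GroupLasso

end GroupLassoOracle

/-- Oracle inequalities in probability (at any level `1-δ`, with `q = Φ⁻¹(1-δ)`)
and in expectation for the group LASSO.  The oracle bound (with the convention
`a/0 = +∞`) is expressed in `ℝ≥0∞`, and `𝒦(β) = S` as `∀ k, k ∈ S ↔ β_{G_k} ≠ 0`. -/
theorem stmt12 (n p M T : ℕ) (hn : 0 < n)
    (G : Fin M → Finset (Fin p))
    (hdisj : ∀ k l : Fin M, k ≠ l → Disjoint (G k) (G l))
    (hcover : Finset.univ.biUnion G = (Finset.univ : Finset (Fin p)))
    (hcard : ∀ k : Fin M, (G k).card = T)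
    (σ : ℝ) (hσ : 0 < σ) (f : Fin n → ℝ)
    (X : Matrix (Fin n) (Fin p) ℝ)
    (hdiag : ∀ j : Fin p, (1 / n) * ∑ i, X i j ^ 2 ≤ 1)
    (ψstar : ℝ) (hψ : ψstar = (⨆ k : Fin M, subSpecNorm X (G k)) / Real.sqrt n)
    (lam : ℝ)
    (hlam : 2 * σ / Real.sqrt n *
      (Real.sqrt T + ψstar * Real.sqrt (2 * Real.log (2 * M))) ≤ lam)
    (βhat : (Fin n → ℝ) → (Fin p → ℝ))
    (hmin : ∀ (y : Fin n → ℝ) (b : Fin p → ℝ),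
      scaledNorm (y - X.mulVec (βhat y)) ^ 2 + 2 * lam * ∑ k, groupNorm (G k) (βhat y)
        ≤ scaledNorm (y - X.mulVec b) ^ 2 + 2 * lam * ∑ k, groupNorm (G k) b)
    (δ : ℝ) (hδ0 : 0 < δ) (hδ1 : δ < 1)
    (q : ℝ) (hq : stdPhi q = 1 - δ) :
    (gaussianVec n σ
        {ξ | ENNReal.ofReal (scaledNorm (X.mulVec (βhat (f + ξ)) - f))
          ≤ (⨅ (S : Finset (Fin M)) (β : Fin p → ℝ)
                (_ : ∀ k : Fin M, k ∈ S ↔ ∃ j ∈ G k, β j ≠ 0),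
              (ENNReal.ofReal (scaledNorm (X.mulVec β - f)) +
                ENNReal.ofReal (3 * lam * Real.sqrt S.card) /
                  ENNReal.ofReal (2 * Real.sqrt (kappaGSq X G S 3))))
            + ENNReal.ofReal (σ * q / Real.sqrt n)}
      ≥ 1 - ENNReal.ofReal δ) ∧
    (∫⁻ ξ, ENNReal.ofReal (scaledNorm (X.mulVec (βhat (f + ξ)) - f)) ∂(gaussianVec n σ)
      ≤ (⨅ (S : Finset (Fin M)) (β : Fin p → ℝ)
            (_ : ∀ k : Fin M, k ∈ S ↔ ∃ j ∈ G k, β j ≠ 0),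
          (ENNReal.ofReal (scaledNorm (X.mulVec β - f)) +
            ENNReal.ofReal (3 * lam * Real.sqrt S.card) /
              ENNReal.ofReal (2 * Real.sqrt (kappaGSq X G S 3))))
        + ENNReal.ofReal (σ / Real.sqrt (2 * Real.pi * n))) := by
  classical
  set R := ⨅ (S : Finset (Fin M)) (β : Fin p → ℝ)
    (_ : ∀ k : Fin M, k ∈ S ↔ ∃ j ∈ G k, β j ≠ 0),
    (ENNReal.ofReal (scaledNorm (X.mulVec β - f)) +
      ENNReal.ofReal (3 * lam * Real.sqrt S.card) /
        ENNReal.ofReal (2 * Real.sqrt (kappaGSq X G S 3))) with hR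
  have hn0 : (0 : ℝ) < n := by exact_mod_cast hn
  have hsn : 0 < √(n : ℝ) := Real.sqrt_pos.2 hn0
  have hlam0 : 0 ≤ lam := by
    refine le_trans ?_ hlam
    have hψ0 : 0 ≤ ψstar := by
      rw [hψ]
      exact div_nonneg (Real.iSup_nonneg fun k => subSpecNorm_nonneg X (G k)) hsn.le
    positivity
  have hRtop : R ≠ ⊤ := by
    refine ne_top_of_le_ne_top ?_ (iInf_le_of_le ∅ (iInf_le_of_le 0 (iInf_le_of_le ?_ le_rfl)))
    · simp
    · simp
  set H : (Fin n → ℝ) → ℝ := fun ξ => scaledNorm (X.mulVec (βhat (f + ξ)) - f) with hH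
  set F : EuclideanSpace ℝ (Fin n) → ℝ := fun z => H (σ • WithLp.ofLp z) with hF
  have hlip : ∀ z z', F z - F z' ≤ σ / √n * ‖z - z'‖ := fun z z' => by
    have h := scaledNorm_fit_sub_le (f := f) hn hlam0 hmin (σ • z) (σ • z')
    rw [← smul_sub, norm_smul, Real.norm_of_nonneg hσ.le] at h
    exact h.trans_eq (by ring)
  have hFle : ∀ z ∈ noiseEvent X G σ (n * lam / 2), F z ≤ R.toReal := fun z hz => by
    refine (ENNReal.ofReal_le_iff_le_toReal hRtop).1 ?_
    refine le_iInf fun S => le_iInf fun β => le_iInf fun hβ => ?_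
    refine ofReal_scaledNorm_le hn hdisj hcover hlam0 hmin hz fun k hk j hj => ?_
    by_contra h
    exact hk ((hβ k).2 ⟨j, hj, h⟩)
  have hHc : Continuous H := by
    have hl : LipschitzWith ⟨(√(n : ℝ))⁻¹, by positivity⟩
        fun z : EuclideanSpace ℝ (Fin n) => H (WithLp.ofLp z) :=
      LipschitzWith.of_le_add_mul _ fun z z' => by
        have h := scaledNorm_fit_sub_le (f := f) hn hlam0 hmin z z'
        rw [div_eq_inv_mul, ← dist_eq_norm] at h
        exact sub_le_iff_le_add'.1 h
    exact hl.continuous.comp (PiLp.continuous_toLp 2 _)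
  have hFc : Continuous F := hHc.comp (by fun_prop)
  have hclosed := isClosed_noiseEvent X G σ (n * lam / 2)
  have hconv := convex_noiseEvent X G σ (n * lam / 2)
  have hhalf := half_le_measureReal_noiseEvent hn hcard hσ hdiag hψ hlam
  have hc : 0 < σ / √n := by positivity
  have hmap : Measurable fun z : EuclideanSpace ℝ (Fin n) => σ • WithLp.ofLp z := by fun_prop
  constructor
  · have key : ∀ t : ℝ, 0 ≤ t → ENNReal.ofReal (stdPhi t) ≤
        gaussianVec n σ {ξ | ENNReal.ofReal (H ξ) ≤ R + ENNReal.ofReal (σ * t / √n)} := by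
      intro t ht
      rw [gaussianVec_eq_map, Measure.map_apply hmap (measurableSet_le
        hHc.measurable.ennreal_ofReal measurable_const)]
      have h := stdPhi_le_measureReal_of_lipschitz hclosed hconv hhalf hc.le hlip hFle ht
      refine (ENNReal.ofReal_le_of_le_toReal h).trans (measure_mono fun z hz => ?_)
      change ENNReal.ofReal (F z) ≤ R + _
      rw [← ENNReal.ofReal_toReal hRtop, mul_div_right_comm]
      exact (ENNReal.ofReal_le_ofReal hz).trans ENNReal.ofReal_add_le
    rw [ge_iff_le, ← ENNReal.ofReal_one, ← ENNReal.ofReal_sub _ hδ0.le, ← hq]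
    rcases le_total 0 q with h | h
    · exact key q h
    · have h0 := key 0 le_rfl
      rw [mul_zero, zero_div] at h0
      refine (ENNReal.ofReal_le_ofReal (strictMono_stdPhi.monotone h)).trans
        (h0.trans (measure_mono fun ξ hξ => ?_))
      refine le_trans (Set.mem_ofPred_eq ▸ hξ) ?_
      rw [ENNReal.ofReal_zero]
      gcongr
      exact zero_le
  · rw [gaussianVec_eq_map, lintegral_map hHc.measurable.ennreal_ofReal hmap]
    refine (lintegral_ofReal_le_of_lipschitz hclosed hconv hhalf hc hFc hlip hFle).trans_eq ?_
    rw [ENNReal.ofReal_toReal hRtop, Real.sqrt_mul (by positivity) (n : ℝ)]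
    congr 2
    field_simp
end

section
/- Let 𝒜 ⊂ (0,+∞)ᵖ be a polyhedral convex cone, let 𝒜′ be the closure of 𝒜 ∩ {a : |a|₁ ≤ 1}, and let ℰ_{𝒜′} be the set of extremal points of 𝒜′. Let ξ ∼ N(0, σ²I_{n×n}) and assume the diagonal elements of (1/n)𝕏ᵀ𝕏 are at most 1. If λ ≥ (2σ/√n)( 1 + √(2 log(2|ℰ_{𝒜′}|)) ), then P( ‖(1/n)𝕏ᵀξ‖_{𝒜,∘} ≤ λ/2 ) ≥ 1/2, where ‖β‖_{𝒜,∘} = sup_{a∈𝒜: |a|₁≤1} (∑_{j=1}^p a_j β_j²)^{1/2}. -/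
open MeasureTheory ProbabilityTheory
open scoped ENNReal

/-- The dual norm `‖β‖_{𝒜,∘} = sup_{a ∈ 𝒜, |a|₁ ≤ 1} (∑_j a_j β_j²)^{1/2}`. -/
noncomputable def coneDualNorm {p : ℕ} (A : Set (Fin p → ℝ)) (β : Fin p → ℝ) : ℝ :=
  sSup {r | ∃ a ∈ A, (∑ j, |a j|) ≤ 1 ∧ r = Real.sqrt (∑ j, a j * β j ^ 2)}

/-- The Gaussian integral bound `𝔼 exp (s g²) ≤ u` for `g ∼ N(0, v)`, `v ≤ τ` and
`2 s τ = 1 - 1 / u²`. -/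
lemma lintegral_exp_sq_gaussianReal_le {τ u : ℝ} (hτ : 0 < τ) (hu : 1 ≤ u) (v : NNReal)
    (hv : (v : ℝ) ≤ τ) :
    ∫⁻ x, ENNReal.ofReal (Real.exp ((1 - 1 / u ^ 2) / (2 * τ) * x ^ 2)) ∂(gaussianReal 0 v)
      ≤ ENNReal.ofReal u := by
  have hu0 : 0 < u := by linarith
  have hu2 : 1 / u ^ 2 ≤ 1 := by
    rw [div_le_one (by positivity)]
    nlinarith
  set s := (1 - 1 / u ^ 2) / (2 * τ) with hs
  have hs0 : 0 ≤ s := div_nonneg (by linarith) (by positivity)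
  rcases eq_or_ne v 0 with rfl | hv0
  · rw [gaussianReal_zero_var, lintegral_dirac' _ (by fun_prop)]
    simpa using hu
  have hvpos : (0 : ℝ) < v := by positivity
  have hsτ : 2 * s * τ = 1 - 1 / u ^ 2 := by rw [hs]; field_simp
  have hsv : 1 / u ^ 2 ≤ 1 - 2 * s * v := by nlinarith
  have hlt : 0 < 1 - 2 * s * v := lt_of_lt_of_le (by positivity) hsv
  set b : ℝ := (1 - 2 * s * v) / (2 * v) with hb
  have hb0 : 0 < b := by positivity
  rw [gaussianReal_of_var_ne_zero _ hv0,
    lintegral_withDensity_eq_lintegral_mul _ (measurable_gaussianPDF 0 v) (by fun_prop)]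
  have hpt : ∀ x : ℝ, (gaussianPDF 0 v * fun x => ENNReal.ofReal (Real.exp (s * x ^ 2))) x =
      ENNReal.ofReal ((√(2 * Real.pi * v))⁻¹ * Real.exp (-b * x ^ 2)) := by
    intro x
    rw [Pi.mul_apply, gaussianPDF, ← ENNReal.ofReal_mul (gaussianPDFReal_nonneg _ _ _),
      gaussianPDFReal, mul_assoc, ← Real.exp_add]
    congr 3
    rw [hb]
    field_simp
    ring
  simp_rw [hpt]
  rw [← ofReal_integral_eq_lintegral_ofReal ((integrable_exp_neg_mul_sq hb0).const_mul _)
    (Filter.Eventually.of_forall fun x => by positivity), integral_const_mul, integral_gaussian]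
  refine ENNReal.ofReal_le_ofReal ?_
  rw [← Real.sqrt_inv, ← Real.sqrt_mul (by positivity)]
  refine Real.sqrt_le_iff.2 ⟨hu0.le, ?_⟩
  have : (2 * Real.pi * v)⁻¹ * (Real.pi / b) = 1 / (1 - 2 * s * v) := by
    rw [hb]
    have := Real.pi_pos
    field_simp
  rw [this, div_le_iff₀ hlt]
  rw [div_le_iff₀ (by positivity)] at hsv
  linarith

/-- Jensen's inequality for the exponential with weights of total mass at most one. -/
lemma exp_sum_mul_le {ι : Type*} [Fintype ι] {w : ι → ℝ} (hw : ∀ j, 0 ≤ w j)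
    (hw1 : ∑ j, w j ≤ 1) (y : ι → ℝ) :
    Real.exp (∑ j, w j * y j) ≤ (1 - ∑ j, w j) + ∑ j, w j * Real.exp (y j) := by
  set S := ∑ j, w j * y j with hS
  have tangent : ∀ z : ℝ, Real.exp S * (1 + z - S) ≤ Real.exp z := fun z => by
    have h := Real.add_one_le_exp (z - S)
    calc Real.exp S * (1 + z - S) ≤ Real.exp S * Real.exp (z - S) := by
          gcongr
          linarith
      _ = Real.exp z := by rw [← Real.exp_add]; ring_nf
  have h0 : Real.exp S * (1 - S) ≤ 1 := by simpa using tangent 0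
  have h1 : ∑ j, w j * (Real.exp S * (1 + y j - S)) ≤ ∑ j, w j * Real.exp (y j) :=
    Finset.sum_le_sum fun j _ => mul_le_mul_of_nonneg_left (tangent _) (hw j)
  have h2 : ∑ j, w j * (Real.exp S * (1 + y j - S)) =
      Real.exp S * ((∑ j, w j) * (1 - S) + S) := by
    rw [hS, mul_add, Finset.sum_mul, Finset.mul_sum, Finset.mul_sum, ← Finset.sum_add_distrib]
    exact Finset.sum_congr rfl fun j _ => by ring
  have h3 := mul_le_mul_of_nonneg_left h0 (sub_nonneg.2 hw1)
  nlinarith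

/-- Chernoff bound for a sub-convex combination of squares of centred Gaussian variables. -/
lemma measure_lt_sum_mul_sq_le {Ω ι : Type*} [MeasurableSpace Ω] [Fintype ι] (μ : Measure Ω)
    [IsProbabilityMeasure μ] {β : ι → Ω → ℝ} (hβ : ∀ j, Measurable (β j)) {τ : ℝ} (hτ : 0 < τ)
    {v : ι → NNReal} (hlaw : ∀ j, μ.map (β j) = gaussianReal 0 (v j)) (hv : ∀ j, (v j : ℝ) ≤ τ)
    {w : ι → ℝ} (hw : ∀ j, 0 ≤ w j) (hw1 : ∑ j, w j ≤ 1) {u : ℝ} (hu : 1 ≤ u) :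
    μ {ω | τ * u ^ 2 < ∑ j, w j * β j ω ^ 2} ≤
      ENNReal.ofReal (u * Real.exp (-((u ^ 2 - 1) / 2))) := by
  have hu0 : 0 < u := by linarith
  set s := (1 - 1 / u ^ 2) / (2 * τ) with hs
  have hs0 : 0 ≤ s := by
    refine div_nonneg (sub_nonneg.2 ?_) (by positivity)
    rw [div_le_one (by positivity)]
    nlinarith
  have hsu : s * (τ * u ^ 2) = (u ^ 2 - 1) / 2 := by rw [hs]; field_simp
  set f : Ω → ENNReal := fun ω => ENNReal.ofReal (Real.exp (∑ j, w j * (s * β j ω ^ 2))) with hf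
  have hfm : Measurable f := by fun_prop
  have hint : ∫⁻ ω, f ω ∂μ ≤ ENNReal.ofReal u := by
    calc ∫⁻ ω, f ω ∂μ
        ≤ ∫⁻ ω, (ENNReal.ofReal (1 - ∑ j, w j) + ∑ j, ENNReal.ofReal (w j) *
            ENNReal.ofReal (Real.exp (s * β j ω ^ 2))) ∂μ := by
          refine lintegral_mono fun ω => ?_
          refine (ENNReal.ofReal_le_ofReal (exp_sum_mul_le hw hw1 _)).trans_eq ?_
          have hnn : ∀ j ∈ Finset.univ, 0 ≤ w j * Real.exp (s * β j ω ^ 2) := fun j _ =>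
            mul_nonneg (hw j) (Real.exp_pos _).le
          rw [ENNReal.ofReal_add (sub_nonneg.2 hw1) (Finset.sum_nonneg hnn),
            ENNReal.ofReal_sum_of_nonneg hnn]
          simp_rw [ENNReal.ofReal_mul (hw _)]
      _ = ENNReal.ofReal (1 - ∑ j, w j) + ∑ j, ENNReal.ofReal (w j) *
            ∫⁻ x, ENNReal.ofReal (Real.exp (s * x ^ 2)) ∂(gaussianReal 0 (v j)) := by
          rw [lintegral_add_left (by fun_prop), lintegral_finsetSum _ (fun j _ => by fun_prop)]
          simp only [lintegral_const, measure_univ, mul_one]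
          congr 1
          refine Finset.sum_congr rfl fun j _ => ?_
          rw [lintegral_const_mul _ (by fun_prop), ← hlaw j,
            lintegral_map (by fun_prop) (hβ j)]
      _ ≤ ENNReal.ofReal (1 - ∑ j, w j) + ∑ j, ENNReal.ofReal (w j) * ENNReal.ofReal u := by
          gcongr with j
          exact lintegral_exp_sq_gaussianReal_le hτ hu (v j) (hv j)
      _ = ENNReal.ofReal ((1 - ∑ j, w j) + ∑ j, w j * u) := by
          have hnn : ∀ j ∈ Finset.univ, 0 ≤ w j * u := fun j _ => mul_nonneg (hw j) hu0.le
          rw [ENNReal.ofReal_add (sub_nonneg.2 hw1) (Finset.sum_nonneg hnn),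
            ENNReal.ofReal_sum_of_nonneg hnn]
          simp_rw [ENNReal.ofReal_mul (hw _)]
      _ ≤ ENNReal.ofReal u := by
          refine ENNReal.ofReal_le_ofReal ?_
          rw [← Finset.sum_mul]
          nlinarith
  set ε := ENNReal.ofReal (Real.exp ((u ^ 2 - 1) / 2)) with hε
  have hε0 : ε ≠ 0 := (ENNReal.ofReal_pos.2 (Real.exp_pos _)).ne'
  calc μ {ω | τ * u ^ 2 < ∑ j, w j * β j ω ^ 2} ≤ μ {ω | ε ≤ f ω} := by
        refine measure_mono fun ω hω => ENNReal.ofReal_le_ofReal (Real.exp_le_exp.2 ?_)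
        have : ∑ j, w j * (s * β j ω ^ 2) = s * ∑ j, w j * β j ω ^ 2 := by
          rw [Finset.mul_sum]
          exact Finset.sum_congr rfl fun j _ => by ring
        rw [this, ← hsu]
        exact mul_le_mul_of_nonneg_left (le_of_lt hω) hs0
    _ ≤ (∫⁻ ω, f ω ∂μ) / ε :=
        meas_ge_le_lintegral_div hfm.aemeasurable hε0 ENNReal.ofReal_ne_top
    _ ≤ ENNReal.ofReal u / ε := by gcongr
    _ = _ := by
        rw [hε, ← ENNReal.ofReal_div_of_pos (Real.exp_pos _), Real.exp_neg, div_eq_mul_inv]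

lemma gaussianVec_eq_pi (n : ℕ) (σ : ℝ) :
    gaussianVec n σ = Measure.pi fun _ : Fin n => gaussianReal 0 (σ ^ 2).toNNReal := by
  rw [Real.toNNReal_of_nonneg (sq_nonneg σ)]
  rfl

instance (n : ℕ) (σ : ℝ) : IsProbabilityMeasure (gaussianVec n σ) := by
  rw [gaussianVec_eq_pi]
  infer_instance

/-- A linear form of a Gaussian vector with i.i.d. centred components is Gaussian. -/
lemma gaussianVec_map_sum_mul (n : ℕ) (σ : ℝ) (c : Fin n → ℝ) :
    (gaussianVec n σ).map (fun ξ => ∑ i, c i * ξ i) =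
      gaussianReal 0 (σ ^ 2 * ∑ i, c i ^ 2).toNNReal := by
  have hlaw : ∀ i, (gaussianVec n σ).map (fun ξ => c i * ξ i) =
      gaussianReal 0 (σ ^ 2 * c i ^ 2).toNNReal := fun i => by
    have h : (gaussianVec n σ).map (fun ξ => ξ i) = gaussianReal 0 (σ ^ 2).toNNReal := by
      rw [gaussianVec_eq_pi]
      exact (measurePreserving_eval (fun _ : Fin n => gaussianReal 0 (σ ^ 2).toNNReal) i).map_eq
    have h' := gaussianReal_map_const_mul (μ := 0) (v := (σ ^ 2).toNNReal) (c i)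
    rw [← h, Measure.map_map (by fun_prop) (by fun_prop), mul_zero] at h'
    rw [mul_comm, Real.toNNReal_mul (sq_nonneg _), Real.toNNReal_of_nonneg (sq_nonneg (c i))]
    exact h'
  have hind : iIndepFun (fun i (ξ : Fin n → ℝ) => c i * ξ i) (gaussianVec n σ) := by
    rw [gaussianVec_eq_pi]
    exact iIndepFun_pi (X := fun i x => c i * x) (fun i => by fun_prop)
  refine Measure.ext_of_charFun ?_
  rw [hind.charFun_map_fun_sum_eq_prod
    (fun i => (by fun_prop : Measurable fun ξ : Fin n → ℝ => c i * ξ i).aemeasurable)]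
  ext t
  have hnn : ∀ i, max (σ ^ 2 * c i ^ 2) 0 = σ ^ 2 * c i ^ 2 := fun i =>
    max_eq_left (by positivity)
  have hnn' : max (σ ^ 2 * ∑ i, c i ^ 2) 0 = σ ^ 2 * ∑ i, c i ^ 2 :=
    max_eq_left (by positivity)
  simp_rw [Finset.prod_apply, hlaw, charFun_gaussianReal, ← Complex.exp_sum,
    Real.coe_toNNReal', hnn, hnn']
  congr 1
  simp [Finset.mul_sum, Finset.sum_mul, Finset.sum_div]

/-- The part of a cone of nonnegative vectors in the closed `ℓ₁` unit ball has its closure in the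
compact set of nonnegative vectors of total mass at most one. -/
lemma closure_inter_l1Ball_subset {p : ℕ} {A : Set (Fin p → ℝ)} (hApos : ∀ a ∈ A, ∀ j, 0 < a j) :
    closure (A ∩ {a | (∑ j, |a j|) ≤ 1}) ⊆ {a | (∀ j, 0 ≤ a j) ∧ ∑ j, a j ≤ 1} := by
  refine closure_minimal ?_ ?_
  · rintro a ⟨ha, ha1⟩
    exact ⟨fun j => (hApos a ha j).le, (Finset.sum_le_sum fun j _ => le_abs_self _).trans ha1⟩
  · have h1 : IsClosed {a : Fin p → ℝ | ∑ j, a j ≤ 1} :=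
      isClosed_le (by fun_prop) continuous_const
    exact (isClosed_Ici (a := (0 : Fin p → ℝ))).inter h1

lemma isCompact_closure_inter_l1Ball {p : ℕ} {A : Set (Fin p → ℝ)}
    (hApos : ∀ a ∈ A, ∀ j, 0 < a j) :
    IsCompact (closure (A ∩ {a | (∑ j, |a j|) ≤ 1})) := by
  refine (isCompact_Icc (a := (0 : Fin p → ℝ)) (b := 1)).of_isClosed_subset isClosed_closure ?_
  intro a ha
  obtain ⟨h0, h1⟩ := closure_inter_l1Ball_subset hApos ha
  exact ⟨h0, fun j => (Finset.single_le_sum (fun i _ => h0 i) (Finset.mem_univ j)).trans h1⟩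

lemma convex_l1Ball (p : ℕ) : Convex ℝ {a : Fin p → ℝ | (∑ j, |a j|) ≤ 1} := by
  intro a ha b hb s t hs ht hst
  simp only [Set.mem_ofPred_eq] at *
  calc ∑ j, |(s • a + t • b) j| ≤ ∑ j, (s * |a j| + t * |b j|) := by
        refine Finset.sum_le_sum fun j _ => ?_
        simp only [Pi.add_apply, Pi.smul_apply, smul_eq_mul]
        refine (abs_add_le _ _).trans_eq ?_
        rw [abs_mul, abs_mul, abs_of_nonneg hs, abs_of_nonneg ht]
    _ = s * ∑ j, |a j| + t * ∑ j, |b j| := by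
        rw [Finset.sum_add_distrib, Finset.mul_sum, Finset.mul_sum]
    _ ≤ 1 := by nlinarith

/-- The cone dual norm is controlled by the extreme points of the closed unit section. -/
lemma coneDualNorm_le_of_extremePoints {p : ℕ} {A : Set (Fin p → ℝ)}
    (hApos : ∀ a ∈ A, ∀ j, 0 < a j) (hAconv : Convex ℝ A) {β : Fin p → ℝ} {r : ℝ} (hr : 0 ≤ r)
    (h : ∀ e ∈ Set.extremePoints ℝ (closure (A ∩ {a | (∑ j, |a j|) ≤ 1})),
      ∑ j, e j * β j ^ 2 ≤ r ^ 2) :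
    coneDualNorm A β ≤ r := by
  refine Real.sSup_le ?_ hr
  rintro _ ⟨a, ha, ha1, rfl⟩
  refine Real.sqrt_le_iff.2 ⟨hr, ?_⟩
  have hmem : a ∈ closure (A ∩ {a | (∑ j, |a j|) ≤ 1}) := subset_closure ⟨ha, ha1⟩
  rw [← closure_convexHull_extremePoints (isCompact_closure_inter_l1Ball hApos)
    (hAconv.inter (convex_l1Ball p)).closure] at hmem
  have hlin : IsLinearMap ℝ fun a : Fin p → ℝ => ∑ j, a j * β j ^ 2 :=
    ⟨fun a b => by simp [add_mul, Finset.sum_add_distrib],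
      fun c a => by simp [Finset.mul_sum, mul_assoc]⟩
  have hcl : IsClosed {a : Fin p → ℝ | ∑ j, a j * β j ^ 2 ≤ r ^ 2} :=
    isClosed_le (by fun_prop) continuous_const
  exact closure_minimal (convexHull_min h (convex_halfSpace_le hlin _)) hcl hmem

/-- For a polyhedral convex cone `𝒜 ⊂ (0,∞)ᵖ`, the convex polytope
`𝒜′ = closure(𝒜 ∩ {|a|₁ ≤ 1})` has a finite set `ℰ` of extremal points
(this finiteness of `ℰ_{𝒜′}` is how polyhedrality of `𝒜` is encoded:
`E` is a `Finset`).  If `λ ≥ (2σ/√n)(1 + √(2 log(2|ℰ_{𝒜′}|)))`, then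
the event `‖(1/n)Xᵀξ‖_{𝒜,∘} ≤ λ/2` has probability at least `1/2`. -/
theorem stmt15 (n p : ℕ) (hn : 0 < n)
    (A : Set (Fin p → ℝ)) (hAne : A.Nonempty)
    (hApos : ∀ a ∈ A, ∀ j, 0 < a j)
    (hAconv : Convex ℝ A)
    (hAcone : ∀ (c : ℝ), 0 < c → ∀ a ∈ A, c • a ∈ A)
    (E : Finset (Fin p → ℝ))
    (hE : (E : Set (Fin p → ℝ)) =
      Set.extremePoints ℝ (closure (A ∩ {a | (∑ j, |a j|) ≤ 1})))
    (σ : ℝ) (hσ : 0 < σ)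
    (X : Matrix (Fin n) (Fin p) ℝ)
    (hdiag : ∀ j : Fin p, (1 / n) * ∑ i, X i j ^ 2 ≤ 1)
    (lam : ℝ)
    (hlam : 2 * σ / Real.sqrt n * (1 + Real.sqrt (2 * Real.log (2 * E.card))) ≤ lam) :
    gaussianVec n σ
        {ξ | coneDualNorm A (fun j => (1 / n) * X.transpose.mulVec ξ j) ≤ lam / 2}
      ≥ 1/2 := by
  have hn' : (0 : ℝ) < n := by exact_mod_cast hn
  set τ : ℝ := σ ^ 2 / n with hτ
  have hτ0 : 0 < τ := by positivity
  set t : ℝ := √(2 * Real.log (2 * E.card)) with ht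
  have ht0 : 0 ≤ t := Real.sqrt_nonneg _
  have hu : 1 ≤ 1 + t := by linarith
  set β : Fin p → (Fin n → ℝ) → ℝ := fun j ξ => (1 / n) * X.transpose.mulVec ξ j with hβ
  have hβ_eq : ∀ j, β j = fun ξ => ∑ i, (1 / n * X i j) * ξ i := fun j => by
    ext ξ
    simp [hβ, Matrix.mulVec, dotProduct, Finset.mul_sum, mul_assoc]
  have hβm : ∀ j, Measurable (β j) := fun j => by
    rw [hβ_eq]
    fun_prop
  have hvar : ∀ j, ((σ ^ 2 * ∑ i, (1 / n * X i j) ^ 2).toNNReal : ℝ) ≤ τ := fun j => by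
    rw [Real.coe_toNNReal _ (by positivity)]
    have h1 : σ ^ 2 * ∑ i, (1 / n * X i j) ^ 2 = τ * ((1 / n) * ∑ i, X i j ^ 2) := by
      rw [Finset.mul_sum, Finset.mul_sum, Finset.mul_sum]
      refine Finset.sum_congr rfl fun i _ => ?_
      rw [hτ]
      ring
    rw [h1]
    exact mul_le_of_le_one_right hτ0.le (hdiag j)
  have hlam0 : 0 ≤ lam := le_trans (by positivity) hlam
  have hlam2 : τ * (1 + t) ^ 2 ≤ (lam / 2) ^ 2 := by
    have h1 : σ / √n * (1 + t) ≤ lam / 2 := by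
      have : 2 * σ / √n * (1 + t) = 2 * (σ / √n * (1 + t)) := by ring
      linarith
    have h2 : τ * (1 + t) ^ 2 = (σ / √n * (1 + t)) ^ 2 := by
      rw [mul_pow, div_pow, Real.sq_sqrt hn'.le]
    rw [h2]
    exact pow_le_pow_left₀ (by positivity) h1 2
  set bad : (Fin p → ℝ) → Set (Fin n → ℝ) :=
    fun e => {ξ | τ * (1 + t) ^ 2 < ∑ j, e j * β j ξ ^ 2} with hbad
  have hbadm : ∀ e, MeasurableSet (bad e) := fun e =>
    measurableSet_lt measurable_const (by fun_prop)
  have htail : ∀ e ∈ E, gaussianVec n σ (bad e) ≤ ENNReal.ofReal (1 / (2 * E.card)) := by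
    intro e he
    have hcard : (1 : ℝ) ≤ E.card := by exact_mod_cast Finset.card_pos.2 ⟨e, he⟩
    have heA := extremePoints_subset (hE ▸ Finset.mem_coe.2 he)
    obtain ⟨h0, h1⟩ := closure_inter_l1Ball_subset hApos heA
    refine (measure_lt_sum_mul_sq_le (gaussianVec n σ) hβm hτ0
      (fun j => by rw [hβ_eq]; exact gaussianVec_map_sum_mul n σ _) hvar h0 h1 hu).trans
      (ENNReal.ofReal_le_ofReal ?_)
    have ht2 : t ^ 2 / 2 = Real.log (2 * E.card) := by
      rw [ht, Real.sq_sqrt (mul_nonneg zero_le_two (Real.log_nonneg (by linarith)))]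
      ring
    calc (1 + t) * Real.exp (-(((1 + t) ^ 2 - 1) / 2))
        ≤ Real.exp t * Real.exp (-(((1 + t) ^ 2 - 1) / 2)) := by
          gcongr
          linarith [Real.add_one_le_exp t]
      _ = Real.exp (-(t ^ 2 / 2)) := by
          rw [← Real.exp_add]
          ring_nf
      _ = 1 / (2 * E.card) := by
          rw [ht2, Real.exp_neg, Real.exp_log (by linarith), one_div]
  have hunion : gaussianVec n σ (⋃ e ∈ E, bad e) ≤ 1 / 2 := by
    refine (measure_biUnion_finset_le E bad).trans ((Finset.sum_le_sum htail).trans ?_)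
    rw [Finset.sum_const, nsmul_eq_mul]
    rcases E.eq_empty_or_nonempty with rfl | hne
    · simp
    have hcard : (0 : ℝ) < E.card := by exact_mod_cast hne.card_pos
    rw [← ENNReal.ofReal_natCast, ← ENNReal.ofReal_mul hcard.le]
    have h : (E.card : ℝ) * (1 / (2 * E.card)) = 1 / 2 := by field_simp
    rw [h, ENNReal.ofReal_div_of_pos two_pos]
    simp
  have hsub : (⋃ e ∈ E, bad e)ᶜ ⊆
      {ξ | coneDualNorm A (fun j => (1 / n) * X.transpose.mulVec ξ j) ≤ lam / 2} := by
    intro ξ hξ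
    refine coneDualNorm_le_of_extremePoints hApos hAconv (by linarith) fun e he => ?_
    rw [← hE] at he
    by_contra! hlt
    exact hξ (Set.mem_biUnion (Finset.mem_coe.1 he) (hlam2.trans_lt hlt))
  refine le_trans ?_ (measure_mono hsub)
  rw [prob_compl_eq_one_sub (Finset.measurableSet_biUnion E fun e _ => hbadm e)]
  calc (1 / 2 : ENNReal) = 1 - 1 / 2 := by simp
    _ ≤ _ := tsub_le_tsub_left hunion 1
end
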